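/- There exists ε₀ > 0 such that for every ε ∈ (0, ε₀) and every constant α ∈ (0, ε⁸) the following holds, where x = x(ε) is the unique solution in (0,1) of x = (1+ε)(1 − e^{−x}). For every γ > 0 there exist β > 0 and n₀ ∈ ℕ such that for all n ≥ n₀, all d with 1 + ε ≤ d ≤ β·n, and every (n,d,λ)-graph G with λ/d ≤ α^{2/α}: setting p = (1+ε)/d, with probability at least 1 − γ the largest connected component L₁ of the p-site-percolated subgraph G_p satisfies | |V(L₁)| − x·n/d | ≤ 7α·n/d. -/

import Mathlib

open Finset

/-- The adjacency matrix of `G` over `ℝ` is Hermitian. -/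
noncomputable def SimpleGraph.adjHermitian {n : ℕ} (G : SimpleGraph (Fin n)) :
    letI := Classical.decRel G.Adj
    ((G.adjMatrix ℝ).IsHermitian) := by
  letI := Classical.decRel G.Adj
  rw [Matrix.IsHermitian, Matrix.conjTranspose_eq_transpose_of_trivial]
  exact G.isSymm_adjMatrix

/-- `G` is an `(n,d,λ)`-graph: a `d`-regular graph on `n` vertices all of whose
adjacency-matrix eigenvalues, except one eigenvalue equal to `d`, have absolute
value at most `lam`. -/
noncomputable def IsNDLGraph (n d : ℕ) (lam : ℝ) (G : SimpleGraph (Fin n)) : Prop :=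
  letI := Classical.decRel G.Adj
  G.IsRegularOfDegree d ∧
    ∃ i₀ : Fin n, (G.adjHermitian.eigenvalues i₀ = d ∧
      ∀ i : Fin n, i ≠ i₀ → |G.adjHermitian.eigenvalues i| ≤ lam)

/-- `G` has an induced path on `k` vertices. -/
def HasInducedPath {V : Type*} (G : SimpleGraph V) (k : ℕ) : Prop :=
  ∃ f : Fin k → V, Function.Injective f ∧
    ∀ i j : Fin k, G.Adj (f i) (f j) ↔ ((i : ℕ) + 1 = (j : ℕ) ∨ (j : ℕ) + 1 = (i : ℕ))

/-- `G` has an induced cycle of length `k`. -/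
def HasInducedCycle {V : Type*} (G : SimpleGraph V) (k : ℕ) : Prop :=
  3 ≤ k ∧ ∃ f : ZMod k → V, Function.Injective f ∧
    ∀ i j : ZMod k, G.Adj (f i) (f j) ↔ (i - j = 1 ∨ j - i = 1)

open MeasureTheory in
/-- The Bernoulli measure on `Bool` with success probability `p`. -/
noncomputable def bernoulliMeasure (p : ℝ) : Measure Bool :=
  (ENNReal.ofReal p) • Measure.dirac true + (ENNReal.ofReal (1 - p)) • Measure.dirac false

open MeasureTheory in
/-- The site-percolation measure on subsets of `V` (encoded as functions `V → Bool`):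
every vertex is retained independently with probability `p`. -/
noncomputable def percolationMeasure (V : Type*) [Fintype V] (p : ℝ) :
    Measure (V → Bool) :=
  Measure.pi fun _ : V => bernoulliMeasure p

/-- The vertex set retained by the percolation outcome `ω`. -/
def percSet {V : Type*} (ω : V → Bool) : Set V := {v : V | ω v = true}

namespace SitePercolation

/-! ### Finite Bernoulli weights -/

section Weights

variable {V : Type*} [Fintype V] [DecidableEq V]

/-- The probability of the outcome `ω` under site percolation with parameter `p`. -/
noncomputable def weight (p : ℝ) (ω : V → Bool) : ℝ :=
  ∏ v, if ω v = true then p else 1 - p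

/-- The outcome `ω` with the state of `v` switched. -/
def flip (ω : V → Bool) (v : V) : V → Bool := Function.update ω v (!ω v)

/-- The centred indicator that `v` is retained. -/
noncomputable def centred (p : ℝ) (ω : V → Bool) (v : V) : ℝ :=
  (if ω v = true then 1 else 0) - p

omit [Fintype V] in
lemma flip_apply_self (ω : V → Bool) (v : V) : flip ω v v = !ω v := by
  simp [flip]

omit [Fintype V] in
lemma flip_apply_of_ne (ω : V → Bool) {u v : V} (h : u ≠ v) : flip ω v u = ω u := by
  simp [flip, h]

omit [Fintype V] in
lemma flip_flip (ω : V → Bool) (v : V) : flip (flip ω v) v = ω := by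
  ext u
  by_cases h : u = v
  · subst h; simp [flip_apply_self]
  · simp [flip_apply_of_ne _ h]

omit [DecidableEq V] in
lemma weight_nonneg {p : ℝ} (h0 : 0 ≤ p) (h1 : p ≤ 1) (ω : V → Bool) : 0 ≤ weight p ω :=
  Finset.prod_nonneg fun v _ => by split_ifs <;> linarith

lemma sum_weight (p : ℝ) : ∑ ω : V → Bool, weight p ω = 1 := by
  have h := Finset.prod_univ_sum (fun _ : V => (Finset.univ : Finset Bool))
    (fun (_ : V) (b : Bool) => if b = true then p else 1 - p)
  rw [Fintype.piFinset_univ] at h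
  simp only [weight]
  rw [← h]
  simp

lemma weight_mul_centred_flip (p : ℝ) (ω : V → Bool) (v : V) :
    weight p ω * centred p ω v + weight p (flip ω v) * centred p (flip ω v) v = 0 := by
  have h : ∀ ω' : V → Bool, weight p ω' = (if ω' v = true then p else 1 - p) *
      ∏ u ∈ Finset.univ.erase v, if ω' u = true then p else 1 - p := fun ω' =>
    (Finset.mul_prod_erase Finset.univ (fun u => if ω' u = true then p else 1 - p)
      (Finset.mem_univ v)).symm
  have h' : ∏ u ∈ Finset.univ.erase v, (if flip ω v u = true then p else 1 - p) =
      ∏ u ∈ Finset.univ.erase v, (if ω u = true then p else 1 - p) :=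
    Finset.prod_congr rfl fun u hu => by rw [flip_apply_of_ne _ (Finset.ne_of_mem_erase hu)]
  rw [h ω, h (flip ω v), h']
  simp only [centred, flip_apply_self]
  cases ω v <;> simp <;> ring

/-- The state of an adaptively chosen vertex is independent of every quantity that does not
depend on it. -/
lemma sum_weight_mul_centred (p : ℝ) (v : (V → Bool) → V) (H : (V → Bool) → ℝ)
    (hv : ∀ ω, v (flip ω (v ω)) = v ω) (hH : ∀ ω, H (flip ω (v ω)) = H ω) :
    ∑ ω, weight p ω * (centred p ω (v ω) * H ω) = 0 := by
  refine Finset.sum_involution (fun ω _ => flip ω (v ω)) ?_ ?_ (fun _ _ => Finset.mem_univ _) ?_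
  · intro ω _
    simp only [hv, hH]
    linear_combination H ω * weight_mul_centred_flip p ω (v ω)
  · intro ω _ _ h
    have := congrFun h (v ω)
    rw [flip_apply_self] at this
    cases h' : ω (v ω) <;> simp [h'] at this
  · intro ω _
    simp only [hv, flip_flip]

omit [Fintype V] [DecidableEq V] in
lemma centred_sq (p : ℝ) (ω : V → Bool) (v : V) :
    centred p ω v ^ 2 = p * (1 - p) + (1 - 2 * p) * centred p ω v := by
  unfold centred
  split_ifs <;> ring

/-- Second moment of a martingale whose increments are centred indicators of adaptively queried
vertices, multiplied by bounded predictable factors. -/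
lemma sum_weight_mul_sq_le {p B : ℝ} (h0 : 0 ≤ p) (h1 : p ≤ 1) (n : ℕ)
    (M H : ℕ → (V → Bool) → ℝ) (v : ℕ → (V → Bool) → V) (hM0 : ∀ ω, M 0 ω = 0)
    (hstep : ∀ t < n, ∀ ω, M (t + 1) ω = M t ω + centred p ω (v t ω) * H t ω)
    (hv : ∀ t < n, ∀ ω, v t (flip ω (v t ω)) = v t ω)
    (hM : ∀ t < n, ∀ ω, M t (flip ω (v t ω)) = M t ω)
    (hH : ∀ t < n, ∀ ω, H t (flip ω (v t ω)) = H t ω)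
    (hB : ∀ t < n, ∀ ω, |H t ω| ≤ B) :
    ∀ t ≤ n, ∑ ω, weight p ω * M t ω ^ 2 ≤ t * (p * B ^ 2) := by
  intro t
  induction t with
  | zero => intro _; simp [hM0]
  | succ t ih =>
    intro ht
    have ht' : t < n := ht
    have e1 := sum_weight_mul_centred p (v t) (fun ω => 2 * M t ω * H t ω + (1 - 2 * p) * H t ω ^ 2)
      (hv t ht') (fun ω => by simp only [hM t ht', hH t ht'])
    have e2 : ∑ ω, weight p ω * M (t + 1) ω ^ 2 =
        ∑ ω, weight p ω * M t ω ^ 2 + p * (1 - p) * ∑ ω, weight p ω * H t ω ^ 2 +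
        ∑ ω, weight p ω * (centred p ω (v t ω) *
          (2 * M t ω * H t ω + (1 - 2 * p) * H t ω ^ 2)) := by
      rw [Finset.mul_sum, ← Finset.sum_add_distrib, ← Finset.sum_add_distrib]
      refine Finset.sum_congr rfl fun ω _ => ?_
      rw [hstep t ht' ω]
      linear_combination weight p ω * H t ω ^ 2 * centred_sq p ω (v t ω)
    have e3 : ∑ ω, weight p ω * H t ω ^ 2 ≤ B ^ 2 := by
      calc ∑ ω, weight p ω * H t ω ^ 2 ≤ ∑ ω : V → Bool, weight p ω * B ^ 2 := by
            refine Finset.sum_le_sum fun ω _ => mul_le_mul_of_nonneg_left ?_ (weight_nonneg h0 h1 ω)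
            exact sq_le_sq' (abs_le.mp (hB t ht' ω)).1 (abs_le.mp (hB t ht' ω)).2
        _ = B ^ 2 := by rw [← Finset.sum_mul, sum_weight, one_mul]
    have e4 : 0 ≤ ∑ ω, weight p ω * H t ω ^ 2 :=
      Finset.sum_nonneg fun ω _ => mul_nonneg (weight_nonneg h0 h1 ω) (sq_nonneg _)
    rw [e2, e1, add_zero]
    push_cast
    have := ih ht'.le
    nlinarith [mul_le_mul_of_nonneg_left e3 h0, mul_nonneg (mul_nonneg h0 h0) e4]

open Classical in
/-- Chebyshev's inequality. -/
lemma sum_weight_filter_le {p s K : ℝ} (h0 : 0 ≤ p) (h1 : p ≤ 1) (hs : 0 < s)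
    (M : (V → Bool) → ℝ) (hM : ∑ ω, weight p ω * M ω ^ 2 ≤ K) :
    ∑ ω with s < |M ω|, weight p ω ≤ K / s ^ 2 := by
  rw [le_div_iff₀ (by positivity), Finset.sum_mul]
  refine le_trans ?_ hM
  refine (Finset.sum_le_sum fun ω hω => ?_).trans
    (Finset.sum_le_sum_of_subset_of_nonneg (Finset.filter_subset _ _) fun ω _ _ =>
      mul_nonneg (weight_nonneg h0 h1 ω) (sq_nonneg _))
  refine mul_le_mul_of_nonneg_left ?_ (weight_nonneg h0 h1 ω)
  rw [← sq_abs (M ω)]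
  exact pow_le_pow_left₀ hs.le (Finset.mem_filter.mp hω).2.le 2

omit [DecidableEq V] in
lemma percolationMeasure_singleton {p : ℝ} (h0 : 0 ≤ p) (h1 : p ≤ 1) (ω : V → Bool) :
    percolationMeasure V p {ω} = ENNReal.ofReal (weight p ω) := by
  have : MeasureTheory.IsFiniteMeasure (bernoulliMeasure p) := by
    unfold bernoulliMeasure
    constructor
    simp
  unfold percolationMeasure weight
  rw [MeasureTheory.Measure.pi_singleton, ENNReal.ofReal_prod_of_nonneg]
  · refine Finset.prod_congr rfl fun v _ => ?_
    unfold bernoulliMeasure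
    cases ω v <;> simp
  · intro v _
    split_ifs <;> linarith

/-- A set of outcomes whose complement has small weight has large percolation probability. -/
lemma ofReal_one_sub_le_percolationMeasure {p γ : ℝ} (h0 : 0 ≤ p) (h1 : p ≤ 1)
    (S : Set (V → Bool)) [DecidablePred (· ∈ S)] (hS : ∑ ω with ω ∉ S, weight p ω ≤ γ) :
    ENNReal.ofReal (1 - γ) ≤ percolationMeasure V p S := by
  have e : percolationMeasure V p S = ENNReal.ofReal (∑ ω with ω ∈ S, weight p ω) := by
    have hS' : S = ((Finset.univ.filter fun ω => ω ∈ S : Finset (V → Bool)) : Set (V → Bool)) := by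
      ext; simp
    conv_lhs => rw [hS']
    rw [← MeasureTheory.sum_measure_singleton,
      ENNReal.ofReal_sum_of_nonneg fun ω _ => weight_nonneg h0 h1 ω]
    exact Finset.sum_congr rfl fun ω _ => percolationMeasure_singleton h0 h1 ω
  rw [e]
  refine ENNReal.ofReal_le_ofReal ?_
  have := Finset.sum_filter_add_sum_filter_not Finset.univ (fun ω => ω ∈ S) (weight (V := V) p)
  rw [sum_weight] at this
  linarith

end Weights

/-! ### The exploration process -/

section Exploration

variable {V : Type*} [Fintype V] [DecidableEq V]

open Classical in
/-- The vertices with a neighbour in `R`. -/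
noncomputable def nbhd (G : SimpleGraph V) (R : Finset V) : Finset V :=
  univ.filter fun w => ∃ u ∈ R, G.Adj u w

/-- An element of `S`, if there is one. -/
noncomputable def pick [Nonempty V] (S : Finset V) : V :=
  if h : S.Nonempty then h.choose else Classical.arbitrary V

/-- The vertex to be queried after the vertices of `Q` have been queried and those of `R` have
been found to be retained: a neighbour of `R` whenever possible. -/
noncomputable def nextVertex [Nonempty V] (G : SimpleGraph V) (Q R : Finset V) : V :=
  if (nbhd G R \ Q).Nonempty then pick (nbhd G R \ Q) else pick Qᶜ

/-- The retained vertices in `Q`. -/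
def retained (ω : V → Bool) (Q : Finset V) : Finset V := Q.filter fun v => ω v = true

variable [Nonempty V] (G : SimpleGraph V)

/-- The set of vertices queried in the first `t` steps. -/
noncomputable def queried (ω : V → Bool) : ℕ → Finset V
  | 0 => ∅
  | t + 1 => insert (nextVertex G (queried ω t) (retained ω (queried ω t))) (queried ω t)

/-- The retained vertices found in the first `t` steps. -/
noncomputable def found (ω : V → Bool) (t : ℕ) : Finset V := retained ω (queried G ω t)

/-- The vertex queried in step `t + 1`. -/
noncomputable def query (ω : V → Bool) (t : ℕ) : V :=
  nextVertex G (queried G ω t) (found G ω t)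

/-- No retained vertex found so far has an unqueried neighbour. -/
def Closed (ω : V → Bool) (t : ℕ) : Prop := nbhd G (found G ω t) ⊆ queried G ω t

omit [Fintype V] [DecidableEq V] in
lemma pick_mem {S : Finset V} (h : S.Nonempty) : pick S ∈ S := by
  unfold pick
  rw [dif_pos h]
  exact h.choose_spec

omit [DecidableEq V] [Nonempty V] in
lemma mem_nbhd {R : Finset V} {w : V} : w ∈ nbhd G R ↔ ∃ u ∈ R, G.Adj u w := by
  simp [nbhd]

omit [DecidableEq V] [Nonempty V] in
lemma nbhd_mono {R S : Finset V} (h : R ⊆ S) : nbhd G R ⊆ nbhd G S := by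
  intro w
  simp only [mem_nbhd]
  rintro ⟨u, hu, hw⟩
  exact ⟨u, h hu, hw⟩

lemma queried_succ (ω : V → Bool) (t : ℕ) :
    queried G ω (t + 1) = insert (query G ω t) (queried G ω t) := rfl

lemma mem_found {ω : V → Bool} {t : ℕ} {v : V} :
    v ∈ found G ω t ↔ v ∈ queried G ω t ∧ ω v = true := by
  simp [found, retained]

lemma queried_mono (ω : V → Bool) : Monotone (queried G ω) :=
  monotone_nat_of_le_succ fun _ => Finset.subset_insert _ _

lemma found_mono (ω : V → Bool) : Monotone (found G ω) :=
  fun _ _ h => Finset.filter_subset_filter _ (queried_mono G ω h)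

lemma query_mem_nbhd {ω : V → Bool} {t : ℕ} (h : ¬ Closed G ω t) :
    query G ω t ∈ nbhd G (found G ω t) := by
  have h' : (nbhd G (found G ω t) \ queried G ω t).Nonempty := by
    rwa [Finset.sdiff_nonempty]
  unfold query nextVertex
  rw [if_pos h']
  exact (Finset.mem_sdiff.mp (pick_mem h')).1

lemma card_queried_le (ω : V → Bool) (t : ℕ) : (queried G ω t).card ≤ t := by
  induction t with
  | zero => simp [queried]
  | succ t ih => exact (Finset.card_insert_le _ _).trans (Nat.succ_le_succ ih)

lemma query_notMem {ω : V → Bool} {t : ℕ} (ht : t < Fintype.card V) :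
    query G ω t ∉ queried G ω t := by
  unfold query nextVertex
  split_ifs with h
  · exact (Finset.mem_sdiff.mp (pick_mem h)).2
  · have : (queried G ω t)ᶜ.Nonempty := by
      rw [← Finset.card_pos, Finset.card_compl]
      have := card_queried_le G ω t
      omega
    exact Finset.mem_compl.mp (pick_mem this)

lemma card_queried {ω : V → Bool} {t : ℕ} (ht : t ≤ Fintype.card V) :
    (queried G ω t).card = t := by
  induction t with
  | zero => simp [queried]
  | succ t ih => rw [queried_succ, Finset.card_insert_of_notMem (query_notMem G ht),
      ih (Nat.le_of_succ_le ht)]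

lemma queried_card (ω : V → Bool) : queried G ω (Fintype.card V) = univ :=
  Finset.card_eq_iff_eq_univ _ |>.mp (card_queried G le_rfl)

lemma closed_card (ω : V → Bool) : Closed G ω (Fintype.card V) := by
  unfold Closed
  rw [queried_card]
  exact Finset.subset_univ _

lemma closed_zero (ω : V → Bool) : Closed G ω 0 := by
  simp [Closed, found, retained, queried, nbhd]

/-- The queried set depends only on the states of the queried vertices. -/
lemma queried_congr {ω ω' : V → Bool} {t : ℕ} (h : ∀ v ∈ queried G ω t, ω' v = ω v) :
    queried G ω' t = queried G ω t := by
  induction t with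
  | zero => rfl
  | succ t ih =>
    have h' : ∀ v ∈ queried G ω t, ω' v = ω v := fun v hv =>
      h v (Finset.mem_insert_of_mem hv)
    have e := ih h'
    have e' : retained ω' (queried G ω t) = retained ω (queried G ω t) :=
      Finset.filter_congr fun v hv => by rw [h' v hv]
    rw [queried, queried, e, e']

lemma queried_flip {ω : V → Bool} {t : ℕ} (ht : t < Fintype.card V) :
    queried G (flip ω (query G ω t)) t = queried G ω t := by
  refine queried_congr G fun v hv => flip_apply_of_ne _ ?_
  rintro rfl
  exact query_notMem G ht hv

lemma found_flip {ω : V → Bool} {t : ℕ} (ht : t < Fintype.card V) :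
    found G (flip ω (query G ω t)) t = found G ω t := by
  unfold found
  rw [queried_flip G ht]
  refine Finset.filter_congr fun v hv => ?_
  rw [flip_apply_of_ne]
  rintro rfl
  exact query_notMem G ht hv

lemma query_flip {ω : V → Bool} {t : ℕ} (ht : t < Fintype.card V) :
    query G (flip ω (query G ω t)) t = query G ω t := by
  conv_lhs => rw [query, queried_flip G ht, found_flip G ht]
  rfl

lemma found_succ (ω : V → Bool) (t : ℕ) : found G ω (t + 1) =
    if ω (query G ω t) = true then insert (query G ω t) (found G ω t) else found G ω t := by
  conv_lhs => rw [found, retained, queried_succ, Finset.filter_insert]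
  rfl

lemma card_nbhd_le_of_closed {ω : V → Bool} {t : ℕ} (h : Closed G ω t) :
    (nbhd G (found G ω t)).card ≤ t :=
  (Finset.card_le_card h).trans (card_queried_le G ω t)

/-- Between two closed times, all queried vertices but the first one are new neighbours of the
vertices found. -/
lemma le_card_nbhd {ω : V → Bool} {s t : ℕ} (hst : s < t) (ht : t ≤ Fintype.card V)
    (hs : Closed G ω s) (h : ∀ i, s < i → i < t → ¬ Closed G ω i) :
    t + (nbhd G (found G ω s)).card ≤ (nbhd G (found G ω t)).card + s + 1 := by
  have key : ∀ i, s + 1 ≤ i → i ≤ t →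
      queried G ω i \ queried G ω (s + 1) ⊆ nbhd G (found G ω t) \ nbhd G (found G ω s) := by
    intro i hi
    induction i, hi using Nat.le_induction with
    | base => intro _; simp
    | succ i hi ih =>
      intro hit v hv
      rw [queried_succ, Finset.mem_sdiff, Finset.mem_insert] at hv
      obtain ⟨rfl | hv, hv'⟩ := hv
      · refine Finset.mem_sdiff.mpr ⟨?_, fun hc => hv' (queried_mono G ω (Nat.le_succ s) (hs hc))⟩
        exact nbhd_mono G (found_mono G ω (Nat.le_of_succ_le hit))
          (query_mem_nbhd G (h i (by omega) (by omega)))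
      · exact ih (by omega) (Finset.mem_sdiff.mpr ⟨hv, hv'⟩)
  have h1 := Finset.card_le_card (key t hst le_rfl)
  rw [Finset.card_sdiff_of_subset (queried_mono G ω hst),
    Finset.card_sdiff_of_subset (nbhd_mono G (found_mono G ω hst.le)),
    card_queried G ht, card_queried G (by omega : s + 1 ≤ _)] at h1
  have h2 := Finset.card_le_card (nbhd_mono G (found_mono G ω hst.le))
  omega

/-- At a closed time the vertices found form a union of components. -/
lemma mem_found_iff_of_closed {ω : V → Bool} {t : ℕ} (h : Closed G ω t) {u w : percSet ω}
    (huw : (G.induce (percSet ω)).Reachable u w) :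
    (u : V) ∈ found G ω t ↔ (w : V) ∈ found G ω t := by
  have key : ∀ u w : percSet ω, (G.induce (percSet ω)).Adj u w →
      (u : V) ∈ found G ω t → (w : V) ∈ found G ω t := by
    intro u w huw hu
    exact (mem_found G).mpr ⟨h ((mem_nbhd G).mpr ⟨u, hu, huw⟩), w.2⟩
  obtain ⟨p⟩ := huw
  induction p with
  | nil => rfl
  | cons hadj _ ih =>
    exact ⟨fun hu => ih.mp (key _ _ hadj hu), fun hw => key _ _ hadj.symm (ih.mpr hw)⟩

/-- Every component is explored between two consecutive closed times. -/
lemma exists_closed_times (ω : V → Bool) (C : (G.induce (percSet ω)).ConnectedComponent) :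
    ∃ s t, s < t ∧ t ≤ Fintype.card V ∧
      C.supp.ncard + (found G ω s).card ≤ (found G ω t).card ∧
      t + (nbhd G (found G ω s)).card ≤ (nbhd G (found G ω t)).card + s + 1 := by
  classical
  obtain ⟨v, rfl⟩ := C.exists_rep
  change ∃ s t, s < t ∧ t ≤ Fintype.card V ∧
      ((G.induce (percSet ω)).connectedComponentMk v).supp.ncard + _ ≤ _ ∧ _
  have hex : ∃ t, Closed G ω t ∧ (v : V) ∈ found G ω t :=
    ⟨Fintype.card V, closed_card G ω, (mem_found G).mpr ⟨by simp [queried_card], v.2⟩⟩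
  obtain ⟨hct, hvt⟩ := Nat.find_spec hex
  have hmin : ∀ m, m < Nat.find hex → ¬ (Closed G ω m ∧ (v : V) ∈ found G ω m) :=
    fun m hm => Nat.find_min hex hm
  have htn : Nat.find hex ≤ Fintype.card V :=
    Nat.find_le ⟨closed_card G ω, (mem_found G).mpr ⟨by simp [queried_card], v.2⟩⟩
  generalize Nat.find hex = t at *
  have ht0 : 0 < t := by
    rcases Nat.eq_zero_or_pos t with rfl | h
    · simp [found, retained, queried] at hvt
    · exact h
  set s := Nat.findGreatest (Closed G ω) (t - 1) with hsdef
  have hcs : Closed G ω s := Nat.findGreatest_spec (Nat.zero_le _) (closed_zero G ω)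
  have hst : s < t := by
    have := Nat.findGreatest_le (P := Closed G ω) (t - 1)
    omega
  have hvs : (v : V) ∉ found G ω s := fun hc => hmin s hst ⟨hcs, hc⟩
  refine ⟨s, t, hst, htn, ?_, le_card_nbhd G hst htn hcs fun i hi hit =>
    Nat.findGreatest_is_greatest hi (by omega)⟩
  have hsub : (Subtype.val '' ((G.induce (percSet ω)).connectedComponentMk v).supp : Set V) ⊆
      ((found G ω t \ found G ω s : Finset V) : Set V) := by
    rintro _ ⟨w, hw, rfl⟩
    have hw' : (G.induce (percSet ω)).Reachable v w :=
      (SimpleGraph.ConnectedComponent.exact hw).symm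
    rw [Finset.mem_coe, Finset.mem_sdiff]
    exact ⟨(mem_found_iff_of_closed G hct hw').mp hvt,
      fun hc => hvs ((mem_found_iff_of_closed G hcs hw').mpr hc)⟩
  have h1 := Set.ncard_le_ncard hsub (Finset.finite_toSet _)
  rw [Set.ncard_image_of_injective _ Subtype.val_injective, Set.ncard_coe_finset,
    Finset.card_sdiff_of_subset (found_mono G ω hst.le)] at h1
  have h2 := Finset.card_le_card (found_mono G ω hst.le)
  omega

/-- If there is no closed time in an interval, then all vertices found in that interval belong to
one component. -/
lemma exists_component {ω : V → Bool} {k l : ℕ} (hkl : k ≤ l) (hl : l ≤ Fintype.card V)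
    (h : ∀ i, k ≤ i → i ≤ l → i < (nbhd G (found G ω i)).card) :
    ∃ C : (G.induce (percSet ω)).ConnectedComponent,
      (found G ω l).card ≤ C.supp.ncard + (found G ω k).card := by
  classical
  have hopen : ∀ i, k ≤ i → i ≤ l → ¬ Closed G ω i := fun i hki hil hc =>
    absurd (card_nbhd_le_of_closed G hc) (not_le.mpr (h i hki hil))
  set s := Nat.findGreatest (Closed G ω) k with hsdef
  have hcs : Closed G ω s := Nat.findGreatest_spec (Nat.zero_le _) (closed_zero G ω)
  have hsk : s < k := lt_of_le_of_ne (Nat.findGreatest_le k)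
    fun hc => hopen k le_rfl hkl (hc ▸ hcs)
  have hopen' : ∀ i, s < i → i ≤ l → ¬ Closed G ω i := by
    intro i hi hil
    rcases le_or_gt i k with hik | hik
    · exact Nat.findGreatest_is_greatest hi hik
    · exact hopen i hik.le hil
  have hv : ω (query G ω s) = true := by
    by_contra hc
    refine hopen' (s + 1) (Nat.lt_succ_self s) (by omega) ?_
    have e : found G ω (s + 1) = found G ω s := by rw [found_succ, if_neg hc]
    unfold Closed
    rw [e]
    exact hcs.trans (queried_mono G ω (Nat.le_succ s))
  set v : percSet ω := ⟨query G ω s, hv⟩ with hvdef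
  have key : ∀ i, s + 1 ≤ i → i ≤ l → ∀ w (hw : ω w = true), w ∈ found G ω i \ found G ω s →
      (G.induce (percSet ω)).Reachable v ⟨w, hw⟩ := by
    intro i hi
    induction i, hi using Nat.le_induction with
    | base =>
      intro _ w hw hmem
      rw [found_succ, if_pos hv, Finset.mem_sdiff, Finset.mem_insert] at hmem
      obtain ⟨rfl | hc, hn⟩ := hmem
      · rfl
      · exact absurd hc hn
    | succ i hi ih =>
      intro hil w hw hmem
      rw [Finset.mem_sdiff, mem_found, queried_succ, Finset.mem_insert] at hmem
      obtain ⟨⟨hq | hq, -⟩, hn⟩ := hmem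
      · subst hq
        obtain ⟨u, hu, huw⟩ := (mem_nbhd G).mp (query_mem_nbhd G (hopen' i hi (by omega)))
        have hus : u ∉ found G ω s := fun hc =>
          query_notMem G (by omega : i < _)
            (queried_mono G ω (by omega : s ≤ i) (hcs ((mem_nbhd G).mpr ⟨u, hc, huw⟩)))
        have hω := ((mem_found G).mp hu).2
        have h1 := ih (by omega) u hω (Finset.mem_sdiff.mpr ⟨hu, hus⟩)
        refine h1.trans (SimpleGraph.Adj.reachable ?_)
        exact huw
      · exact ih (by omega) w hw (Finset.mem_sdiff.mpr ⟨(mem_found G).mpr ⟨hq, hw⟩, hn⟩)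
  refine ⟨(G.induce (percSet ω)).connectedComponentMk v, ?_⟩
  have hsub : ((found G ω l \ found G ω s : Finset V) : Set V) ⊆
      (Subtype.val '' ((G.induce (percSet ω)).connectedComponentMk v).supp : Set V) := by
    intro w hw
    rw [Finset.mem_coe] at hw
    have hω := ((mem_found G).mp (Finset.mem_sdiff.mp hw).1).2
    refine ⟨⟨w, hω⟩, ?_, rfl⟩
    exact SimpleGraph.ConnectedComponent.sound (key l (by omega) le_rfl w hω hw).symm
  have h1 := Set.ncard_le_ncard hsub (Set.toFinite _)
  rw [Set.ncard_image_of_injective _ Subtype.val_injective, Set.ncard_coe_finset,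
    Finset.card_sdiff_of_subset (found_mono G ω (by omega))] at h1
  have h2 := Finset.card_le_card (found_mono G ω hsk.le)
  omega

end Exploration

/-! ### The two martingales -/

section Martingales

variable {V : Type*} [Fintype V] [DecidableEq V] (G : SimpleGraph V)

open Classical in
/-- The number of neighbours of `w` in `Q`. -/
noncomputable def degInto (Q : Finset V) (w : V) : ℕ := (Q.filter (G.Adj w)).card

/-- The sum of `a ^ deg` over the vertices outside the neighbourhood of `R`, where `deg` is
the number of neighbours in `Q`. -/
noncomputable def potential (a : ℝ) (Q R : Finset V) : ℝ :=
  ∑ w, if w ∈ nbhd G R then 0 else a ^ degInto G Q w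

open Classical in
/-- The part of the potential that is carried by the neighbours of `v`. -/
noncomputable def localPotential (a : ℝ) (Q R : Finset V) (v : V) : ℝ :=
  ∑ w, if w ∈ nbhd G R then 0 else if G.Adj v w then a ^ degInto G Q w else 0

omit [Fintype V] in
open Classical in
lemma degInto_insert {Q : Finset V} {v : V} (hv : v ∉ Q) (w : V) :
    degInto G (insert v Q) w = degInto G Q w + if G.Adj v w then 1 else 0 := by
  unfold degInto
  rw [Finset.filter_insert, G.adj_comm w v]
  split_ifs
  · rw [Finset.card_insert_of_notMem (by simp [hv])]
  · rfl

lemma mem_nbhd_insert {R : Finset V} {v w : V} :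
    w ∈ nbhd G (insert v R) ↔ G.Adj v w ∨ w ∈ nbhd G R := by
  simp [mem_nbhd]

lemma potential_insert_insert {p a : ℝ} (ha : a * (1 - p) = 1) {Q : Finset V} (R : Finset V)
    {v : V} (hv : v ∉ Q) : potential G a (insert v Q) (insert v R) =
      potential G a Q R + (1 - p) * (-(a * localPotential G a Q R v)) := by
  classical
  have e : (1 - p) * (-(a * localPotential G a Q R v)) = - localPotential G a Q R v := by
    linear_combination - localPotential G a Q R v * ha
  rw [e]
  unfold potential localPotential
  rw [← sub_eq_add_neg, ← Finset.sum_sub_distrib]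
  refine Finset.sum_congr rfl fun w _ => ?_
  rw [degInto_insert G hv]
  simp only [mem_nbhd_insert]
  by_cases h1 : G.Adj v w <;> by_cases h2 : w ∈ nbhd G R <;> simp [h1, h2]

lemma potential_insert {p a : ℝ} (ha : a * (1 - p) = 1) {Q : Finset V} (R : Finset V)
    {v : V} (hv : v ∉ Q) : potential G a (insert v Q) R =
      potential G a Q R + (0 - p) * (-(a * localPotential G a Q R v)) := by
  classical
  have e : (0 - p) * (-(a * localPotential G a Q R v)) = (a - 1) * localPotential G a Q R v := by
    linear_combination - localPotential G a Q R v * ha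
  rw [e]
  unfold potential localPotential
  rw [Finset.mul_sum, ← Finset.sum_add_distrib]
  refine Finset.sum_congr rfl fun w _ => ?_
  rw [degInto_insert G hv]
  by_cases h1 : G.Adj v w <;> by_cases h2 : w ∈ nbhd G R <;> simp [h1, h2]
  ring

omit [DecidableEq V] in
open Classical in
lemma degInto_le {d : ℕ} (hd : ∀ v, (univ.filter (G.Adj v)).card = d) (Q : Finset V)
    (w : V) : degInto G Q w ≤ d := by
  rw [← hd w]
  exact Finset.card_le_card (Finset.filter_subset_filter _ (Finset.subset_univ _))

open Classical in
lemma abs_localPotential_le {d : ℕ} (hd : ∀ v, (univ.filter (G.Adj v)).card = d) {a : ℝ}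
    (ha : 1 ≤ a) (Q R : Finset V) (v : V) : |localPotential G a Q R v| ≤ d * a ^ d := by
  have hn : 0 ≤ localPotential G a Q R v := by
    refine Finset.sum_nonneg fun w _ => ?_
    split_ifs <;> positivity
  rw [abs_of_nonneg hn]
  calc localPotential G a Q R v ≤ ∑ w, if G.Adj v w then a ^ d else 0 := by
        refine Finset.sum_le_sum fun w _ => ?_
        split_ifs
        · positivity
        · exact le_rfl
        · exact pow_le_pow_right₀ ha (degInto_le G hd Q w)
        · exact le_rfl
    _ = d * a ^ d := by
        rw [← Finset.sum_filter, Finset.sum_const, hd v, nsmul_eq_mul]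

variable [Nonempty V]

lemma sum_weight_mul_card_found_sq_le {p : ℝ} (h0 : 0 ≤ p) (h1 : p ≤ 1) {t : ℕ}
    (ht : t ≤ Fintype.card V) :
    ∑ ω, weight p ω * (((found G ω t).card : ℝ) - p * t) ^ 2 ≤ t * p := by
  have := sum_weight_mul_sq_le (B := 1) h0 h1 (Fintype.card V)
    (fun t ω => ((found G ω t).card : ℝ) - p * t) (fun _ _ => 1) (fun t ω => query G ω t)
    (fun ω => by simp [found, retained, queried])
    (fun t ht ω => by
      have hn : query G ω t ∉ found G ω t := fun hc =>
        query_notMem G ht ((mem_found G).mp hc).1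
      simp only [found_succ, centred]
      split_ifs
      · rw [Finset.card_insert_of_notMem hn]; push_cast; ring
      · push_cast; ring)
    (fun t ht ω => query_flip G ht) (fun t ht ω => by simp only [found_flip G ht])
    (fun _ _ _ => rfl) (fun _ _ _ => by simp) t ht
  simpa using this

open Classical in
lemma sum_weight_mul_potential_sq_le {d : ℕ} (hd : ∀ v, (univ.filter (G.Adj v)).card = d)
    {p a : ℝ} (h0 : 0 ≤ p) (h1 : p ≤ 1) (ha : 1 ≤ a) (hap : a * (1 - p) = 1) {t : ℕ}
    (ht : t ≤ Fintype.card V) :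
    ∑ ω, weight p ω * (potential G a (queried G ω t) (found G ω t) - Fintype.card V) ^ 2 ≤
      t * (p * (a * (d * a ^ d)) ^ 2) := by
  refine sum_weight_mul_sq_le h0 h1 (Fintype.card V)
    (fun t ω => potential G a (queried G ω t) (found G ω t) - Fintype.card V)
    (fun t ω => -(a * localPotential G a (queried G ω t) (found G ω t) (query G ω t)))
    (fun t ω => query G ω t) ?_ ?_ ?_ ?_ ?_ ?_ t ht
  · intro ω
    simp [found, retained, queried, potential, nbhd, degInto]
  · intro t ht ω
    simp only [found_succ, queried_succ, centred]
    split_ifs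
    · rw [potential_insert_insert G hap _ (query_notMem G ht)]; ring
    · rw [potential_insert G hap _ (query_notMem G ht)]; ring
  · exact fun t ht ω => query_flip G ht
  · exact fun t ht ω => by simp only [found_flip G ht, queried_flip G ht]
  · exact fun t ht ω => by simp only [found_flip G ht, queried_flip G ht, query_flip G ht]
  · intro t ht ω
    rw [abs_neg, abs_mul, abs_of_nonneg (by linarith : (0 : ℝ) ≤ a)]
    exact mul_le_mul_of_nonneg_left (abs_localPotential_le G hd ha _ _ _) (by linarith)

end Martingales

/-! ### Degrees into a set in an `(n,d,λ)`-graph -/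

section Spectral

open Classical in
lemma card_filter_adj_of_isNDLGraph {n d : ℕ} {lam : ℝ} {G : SimpleGraph (Fin n)}
    (h : IsNDLGraph n d lam G) (v : Fin n) : (univ.filter (G.Adj v)).card = d := by
  rw [← h.1 v, ← SimpleGraph.card_neighborFinset_eq_degree]
  congr 1
  ext w
  simp

/-- The degrees into a set `Q` are close to `d * |Q| / n` in mean square. -/
lemma sum_sq_degInto_le_of_isNDLGraph {n d : ℕ} {lam : ℝ} {G : SimpleGraph (Fin n)}
    (h : IsNDLGraph n d lam G) (hn : 2 ≤ n) (hlam : lam < d) (Q : Finset (Fin n)) :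
    ∑ w, ((degInto G Q w : ℝ) - d * Q.card / n) ^ 2 ≤
      lam ^ 2 * (Q.card - (Q.card : ℝ) ^ 2 / n) := by
  classical
  obtain ⟨-, i₀, hi₀, hi⟩ := id h
  have hreg := card_filter_adj_of_isNDLGraph h
  let _ : DecidableRel G.Adj := Classical.decRel G.Adj
  set A : Matrix (Fin n) (Fin n) ℝ := G.adjMatrix ℝ with hA
  have hAh : A.IsHermitian := G.adjHermitian
  set b := hAh.eigenvectorBasis with hb
  set μ := hAh.eigenvalues with hμ
  set T : EuclideanSpace ℝ (Fin n) → EuclideanSpace ℝ (Fin n) :=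
    fun f => WithLp.toLp 2 (A.mulVec f.ofLp) with hT
  have hTb : ∀ i, T (b i) = μ i • b i := by
    intro i
    have := hAh.mulVec_eigenvectorBasis i
    simp only [hT]
    ext j
    simpa using congrFun this j
  have hsym : ∀ f g, inner ℝ (T f) g = inner ℝ f (T g) := by
    intro f g
    simp only [hT, EuclideanSpace.inner_eq_star_dotProduct, star_trivial]
    rw [Matrix.dotProduct_mulVec, ← Matrix.mulVec_transpose, G.transpose_adjMatrix]
  have hcoef : ∀ i f, inner ℝ (b i) (T f) = μ i * inner ℝ (b i) f := by
    intro i f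
    rw [← hsym, hTb, inner_smul_left]
    simp
  set one : EuclideanSpace ℝ (Fin n) := WithLp.toLp 2 (fun _ => 1) with hone
  have hTone : T one = (d : ℝ) • one := by
    ext j
    simp only [hT, hone, PiLp.smul_apply, smul_eq_mul, mul_one, Matrix.mulVec, dotProduct]
    simp only [hA, SimpleGraph.adjMatrix_apply, Finset.sum_boole]
    exact_mod_cast hreg j
  have horth : ∀ i, i ≠ i₀ → inner ℝ (b i) one = (0 : ℝ) := by
    intro i hne
    have h1 := hcoef i one
    rw [hTone, inner_smul_right] at h1
    have h2 : μ i ≤ lam := (abs_le.mp (hi i hne)).2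
    have h3 : ((d : ℝ) - μ i) * inner ℝ (b i) one = 0 := by linarith
    rcases mul_eq_zero.mp h3 with h4 | h4
    · linarith
    · exact h4
  set f : EuclideanSpace ℝ (Fin n) :=
    WithLp.toLp 2 (fun w => (if w ∈ Q then 1 else 0) - (Q.card : ℝ) / n) with hf
  have hn0 : (n : ℝ) ≠ 0 := by positivity
  have hTf : ∀ w, T f w = (degInto G Q w : ℝ) - d * Q.card / n := by
    intro w
    have e1 : (degInto G Q w : ℝ) =
        ∑ x, (if G.Adj w x then (1 : ℝ) else 0) * if x ∈ Q then 1 else 0 := by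
      simp only [mul_ite, mul_one, mul_zero]
      rw [← Finset.sum_filter, ← Finset.sum_filter, Finset.sum_const, nsmul_eq_mul, mul_one]
      unfold degInto
      congr 2
      ext x; simp
    have e2 : (d : ℝ) = ∑ x, if G.Adj w x then (1 : ℝ) else 0 := by
      rw [Finset.sum_boole]; exact_mod_cast (hreg w).symm
    simp only [hT, hf, Matrix.mulVec, dotProduct, hA, SimpleGraph.adjMatrix_apply, mul_sub,
      Finset.sum_sub_distrib]
    rw [e1, e2, ← Finset.sum_mul]
    ring
  have hfone : inner ℝ one f = (0 : ℝ) := by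
    simp only [hf, hone, EuclideanSpace.inner_eq_star_dotProduct, star_trivial, dotProduct, mul_one,
      Finset.sum_sub_distrib]
    simp [mul_div_cancel₀ _ hn0]
  have hzero : inner ℝ (b i₀) f = (0 : ℝ) := by
    have h1 := b.sum_inner_mul_inner one f
    rw [hfone, Finset.sum_eq_single i₀] at h1
    · rcases mul_eq_zero.mp h1 with h2 | h2
      · exfalso
        have h3 := b.sum_sq_norm_inner_right one
        rw [Finset.sum_eq_single i₀] at h3
        · rw [real_inner_comm] at h2
          rw [h2] at h3
          simp [hone, EuclideanSpace.norm_sq_eq] at h3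
          exact hn0 h3.symm
        · intro i _ hne
          rw [horth i hne]; simp
        · simp
      · exact h2
    · intro i _ hne
      rw [real_inner_comm, horth i hne, zero_mul]
    · simp
  have hnormf : ‖f‖ ^ 2 = Q.card - (Q.card : ℝ) ^ 2 / n := by
    rw [EuclideanSpace.norm_sq_eq]
    have : ∀ w, ‖f w‖ ^ 2 = (1 - 2 * ((Q.card : ℝ) / n)) * (if w ∈ Q then 1 else 0) +
        ((Q.card : ℝ) / n) ^ 2 := by
      intro w
      rw [Real.norm_eq_abs, sq_abs]
      simp only [hf]
      split_ifs <;> ring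
    simp only [this, Finset.sum_add_distrib, ← Finset.mul_sum]
    simp
    field_simp
    ring
  calc ∑ w, ((degInto G Q w : ℝ) - d * Q.card / n) ^ 2 = ‖T f‖ ^ 2 := by
        rw [EuclideanSpace.norm_sq_eq]
        refine Finset.sum_congr rfl fun w _ => ?_
        rw [hTf, Real.norm_eq_abs, sq_abs]
    _ = ∑ i, ‖inner ℝ (b i) (T f)‖ ^ 2 := (b.sum_sq_norm_inner_right (T f)).symm
    _ ≤ ∑ i, lam ^ 2 * ‖inner ℝ (b i) f‖ ^ 2 := by
        refine Finset.sum_le_sum fun i _ => ?_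
        rw [hcoef, norm_mul, mul_pow]
        by_cases hne : i = i₀
        · rw [hne, hzero]; simp
        · refine mul_le_mul_of_nonneg_right ?_ (sq_nonneg _)
          rw [Real.norm_eq_abs]
          exact pow_le_pow_left₀ (abs_nonneg _) (hi i hne) 2
    _ = lam ^ 2 * ‖f‖ ^ 2 := by rw [← Finset.mul_sum, b.sum_sq_norm_inner_right]
    _ = _ := by rw [hnormf]

end Spectral

/-! ### The survival equation -/

section Analysis

lemma le_of_survival {ε x : ℝ} (hε : 0 < ε) (hε' : ε < 1 / 100) (hx : 0 < x)
    (h : x = (1 + ε) * (1 - Real.exp (-x))) : 3 / 2 * ε ≤ x := by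
  by_contra! hlt
  have h1 := Real.quadratic_le_exp_of_nonneg hx.le
  have h2 : Real.exp (-x) * Real.exp x = 1 := by rw [← Real.exp_add]; simp
  have h3 : Real.exp (-x) * (1 + x + x ^ 2 / 2) ≤ 1 := by
    exact (mul_le_mul_of_nonneg_left h1 (Real.exp_pos _).le).trans h2.le
  have h4 : ((1 + ε) - x) * (1 + x + x ^ 2 / 2) ≤ 1 + ε := by
    have : (1 + ε) * Real.exp (-x) = (1 + ε) - x := by linarith
    rw [← this]
    nlinarith
  have h6 : ε + ε * x / 2 - x / 2 - x ^ 2 / 2 ≤ 0 := by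
    by_contra! h7
    have := mul_pos hx h7
    nlinarith
  nlinarith

/-- Beyond the positive fixed point `y` of `u ↦ 1 - exp (-(1 + ε) * u)` this map lies well below
the identity. -/
lemma one_sub_exp_le {ε y u : ℝ} (hy : 1 - Real.exp (-((1 + ε) * y)) = y) (hy0 : 0 ≤ 1 - y)
    (hgap : (1 + ε) * (1 - y) ≤ 1 - ε / 2) (hu : y ≤ u) :
    1 - Real.exp (-((1 + ε) * u)) ≤ u - ε / 2 * (u - y) := by
  have h1 : Real.exp (-((1 + ε) * u)) = (1 - y) * Real.exp (-((1 + ε) * (u - y))) := by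
    have : 1 - y = Real.exp (-((1 + ε) * y)) := by linarith
    rw [this, ← Real.exp_add]; ring_nf
  have h2 := Real.add_one_le_exp (-((1 + ε) * (u - y)))
  have h3 := mul_le_mul_of_nonneg_left h2 hy0
  rw [h1]
  nlinarith

/-- Inside `(0, y)` the map `u ↦ 1 - exp (-(1 + ε) * u)` lies well above the identity. -/
lemma le_one_sub_exp {ε y α u : ℝ} (hε : 0 < ε) (hε' : ε < 1 / 100)
    (hy : 1 - Real.exp (-((1 + ε) * y)) = y) (hy0 : 0 ≤ 1 - y) (hy1 : 0 ≤ y)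
    (hgap : (1 + ε) * (1 - y) ≤ 1 - ε / 2) (hα : 0 < α) (hα' : α ≤ ε / 100)
    (hu : u ∈ Set.Icc α (y - α)) :
    u + ε * α / 4 ≤ 1 - Real.exp (-((1 + ε) * u)) := by
  have hconc : ConcaveOn ℝ Set.univ fun u : ℝ => 1 - Real.exp (-((1 + ε) * u)) - u := by
    have hc : ConvexOn ℝ Set.univ fun u : ℝ => Real.exp (-((1 + ε) * u)) := by
      refine (convexOn_exp.comp_linearMap (LinearMap.mulLeft ℝ (-(1 + ε)))).congr fun u _ => ?_
      simp only [Function.comp_apply, LinearMap.mulLeft_apply, neg_mul]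
    exact ((concaveOn_const (1 : ℝ) convex_univ).sub hc).sub (convexOn_id convex_univ)
  have hmin := hconc.min_le_of_mem_Icc (Set.mem_univ _) (Set.mem_univ _) hu
  have hz : 0 < (1 + ε) * α := by positivity
  have hz' : (1 + ε) * α ≤ 1 / 2 := by nlinarith
  have hexp := Real.add_one_le_exp ((1 + ε) * α)
  have hexp' := Real.add_one_le_exp (-((1 + ε) * α))
  have hmul : Real.exp (-((1 + ε) * α)) * Real.exp ((1 + ε) * α) = 1 := by
    rw [← Real.exp_add]; simp
  set z := (1 + ε) * α with hzdef
  have hzα : z ≤ 1.01 * α := by nlinarith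
  have hlo : Real.exp (-z) ≤ 1 - z + z ^ 2 := by
    have h1 : Real.exp (-z) * (1 + z) ≤ 1 := by nlinarith [Real.exp_pos (-z)]
    nlinarith [pow_pos hz 3]
  have hhi : Real.exp z ≤ 1 + z + 2 * z ^ 2 := by
    have h1 : (1 - z) * Real.exp z ≤ 1 := by nlinarith [Real.exp_pos z]
    have h2 : 1 ≤ (1 - z) * (1 + z + 2 * z ^ 2) := by nlinarith [sq_nonneg z]
    by_contra! h3
    nlinarith
  have hzsq : z ^ 2 ≤ 1.03 * α ^ 2 := by nlinarith
  have hαsq : α ^ 2 ≤ ε / 100 * α := by nlinarith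
  have hl : ε * α / 4 ≤ 1 - Real.exp (-z) - α := by nlinarith
  have hr : ε * α / 4 ≤ 1 - Real.exp (-((1 + ε) * (y - α))) - (y - α) := by
    have h1 : Real.exp (-((1 + ε) * (y - α))) = (1 - y) * Real.exp z := by
      have : 1 - y = Real.exp (-((1 + ε) * y)) := by linarith
      rw [this, ← Real.exp_add, hzdef]; ring_nf
    rw [h1]
    have h2 := mul_le_mul_of_nonneg_left hhi hy0
    have h3 : (1 - y) * (2 * z ^ 2) ≤ 2 * z ^ 2 := by nlinarith [sq_nonneg z]
    have h4 : (1 - y) * z ≤ (1 - ε / 2) * α := by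
      rw [hzdef]; nlinarith
    nlinarith
  have := (le_min hl hr).trans hmin
  linarith

lemma existsUnique_survival {ε : ℝ} (hε : 0 < ε) (hε' : ε < 1 / 100) :
    ∃! x : ℝ, x ∈ Set.Ioo (0 : ℝ) 1 ∧ x = (1 + ε) * (1 - Real.exp (-x)) := by
  have huniq : ∀ x x' : ℝ, x ∈ Set.Ioo (0 : ℝ) 1 → x' ∈ Set.Ioo (0 : ℝ) 1 →
      x = (1 + ε) * (1 - Real.exp (-x)) → x' = (1 + ε) * (1 - Real.exp (-x')) → x' ≤ x := by
    intro x x' hx hx' h h'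
    by_contra! hlt
    have hc : (0 : ℝ) < 1 + ε := by linarith
    have e : ∀ z : ℝ, (1 + ε) * (z / (1 + ε)) = z := fun z => by field_simp
    have hl := le_of_survival hε hε' hx.1 h
    have hle : x / (1 + ε) ≤ 1 := by rw [div_le_one hc]; linarith [hx.2]
    have h1 := one_sub_exp_le (ε := ε) (y := x / (1 + ε)) (u := x' / (1 + ε))
      (by rw [e, eq_div_iff hc.ne']; linarith) (by linarith)
      (by rw [mul_sub, e]; linarith) (by gcongr)
    rw [e] at h1
    have h2 : 1 - Real.exp (-x') = x' / (1 + ε) := by rw [eq_div_iff hc.ne']; linarith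
    have h3 : x / (1 + ε) < x' / (1 + ε) := by gcongr
    nlinarith
  have hcont : ContinuousOn (fun x : ℝ => (1 + ε) * (1 - Real.exp (-x)) - x) (Set.Icc ε 1) := by
    fun_prop
  have hlo : 0 < (1 + ε) * (1 - Real.exp (-ε)) - ε := by
    have h1 := Real.add_one_lt_exp hε.ne'
    have h2 : Real.exp (-ε) * Real.exp ε = 1 := by rw [← Real.exp_add]; simp
    nlinarith [Real.exp_pos (-ε)]
  have hhi : (1 + ε) * (1 - Real.exp (-1)) - 1 < 0 := by
    have := Real.exp_neg_one_gt_d9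
    nlinarith
  obtain ⟨x, hx, hx0⟩ := intermediate_value_Icc' (by linarith : ε ≤ 1) hcont
    (Set.mem_Icc.mpr ⟨hhi.le, hlo.le⟩)
  have hx0' : x = (1 + ε) * (1 - Real.exp (-x)) := by
    simp only at hx0; linarith
  have hx1 : x < 1 := by
    rcases hx.2.lt_or_eq with h | h
    · exact h
    · rw [h] at hx0; simp only at hx0; linarith
  have hxm : x ∈ Set.Ioo (0 : ℝ) 1 := ⟨by linarith [hx.1], hx1⟩
  refine ⟨x, ⟨hxm, hx0'⟩, ?_⟩
  rintro x' ⟨hx'm, hx'⟩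
  exact le_antisymm (huniq x x' hxm hx'm hx0' hx') (huniq x' x hx'm hxm hx' hx0')

/-- Two monotone functions that are close on a grid are close everywhere, if one of them is
Lipschitz. -/
lemma abs_sub_le_of_grid {F g : ℕ → ℝ} {L e : ℝ} {n m : ℕ} (hn : 0 < n) (hm : 0 < m) (hL : 0 ≤ L)
    (hF : Monotone F) (hg : ∀ s t, s ≤ t → g t - g s ≤ L * (t - s))
    (h : ∀ j ≤ m, |F (j * n / m) - g (j * n / m)| ≤ e) {t : ℕ} (ht : t ≤ n) :
    |F t - g t| ≤ e + L * ((n : ℝ) / m + 1) := by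
  have hm' : (0 : ℝ) < m := by exact_mod_cast hm
  have he : 0 ≤ L * ((n : ℝ) / m + 1) := by positivity
  rcases ht.lt_or_eq with ht | rfl
  · have hj : t * m / n < m := (Nat.div_lt_iff_lt_mul hn).mpr (by nlinarith)
    obtain ⟨j, hjdef⟩ : ∃ j, j = t * m / n := ⟨_, rfl⟩
    rw [← hjdef] at hj
    have hjl : j * n ≤ t * m := by rw [hjdef]; exact Nat.div_mul_le_self _ _
    have hju : t * m < (j + 1) * n := by
      rw [hjdef]; have := Nat.lt_div_mul_add (a := t * m) hn; linarith
    have hs : j * n / m ≤ t := Nat.div_le_of_le_mul (by linarith)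
    have hs' : t ≤ (j + 1) * n / m := (Nat.le_div_iff_mul_le hm).mpr hju.le
    have r1 : ((j * n : ℕ) : ℝ) / m - 1 ≤ ((j * n / m : ℕ) : ℝ) := by
      have := Nat.lt_div_mul_add (a := j * n) hm
      rw [sub_le_iff_le_add, div_le_iff₀ hm']
      have h2 : ((j * n : ℕ) : ℝ) ≤ ((j * n / m * m + m : ℕ) : ℝ) := by exact_mod_cast this.le
      push_cast at h2 ⊢
      linarith
    have r2 : (((j + 1) * n / m : ℕ) : ℝ) ≤ (((j + 1) * n : ℕ) : ℝ) / m := Nat.cast_div_le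
    have r3 : (((j + 1) * n : ℕ) : ℝ) / m = ((j * n : ℕ) : ℝ) / m + n / m := by
      push_cast; ring
    have hs1 : ((j * n / m : ℕ) : ℝ) ≤ t := by exact_mod_cast hs
    have hs1' : (t : ℝ) ≤ (((j + 1) * n / m : ℕ) : ℝ) := by exact_mod_cast hs'
    have a1 := abs_le.mp (h j hj.le)
    have a2 := abs_le.mp (h (j + 1) hj)
    have b1 := hg _ _ hs
    have b2 := hg _ _ hs'
    have c1 : L * ((t : ℝ) - (j * n / m : ℕ)) ≤ L * ((n : ℝ) / m + 1) :=
      mul_le_mul_of_nonneg_left (by linarith) hL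
    have c2 : L * ((((j + 1) * n / m : ℕ) : ℝ) - t) ≤ L * ((n : ℝ) / m + 1) :=
      mul_le_mul_of_nonneg_left (by linarith) hL
    have f1 := hF hs
    have f2 := hF hs'
    rw [abs_le]
    constructor <;> linarith
  · have := h m le_rfl
    rw [Nat.mul_div_cancel_left _ hm] at this
    linarith

lemma abs_exp_sub_exp_le {u v M : ℝ} (hu : u ≤ M) (hv : v ≤ M) :
    |Real.exp u - Real.exp v| ≤ Real.exp M * |u - v| := by
  have key : ∀ u v : ℝ, u ≤ M → v ≤ u → Real.exp u - Real.exp v ≤ Real.exp M * (u - v) := by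
    intro u v hu hvu
    have h1 := Real.add_one_le_exp (v - u)
    have h2 : Real.exp v = Real.exp u * Real.exp (v - u) := by rw [← Real.exp_add]; ring_nf
    have h3 : Real.exp u ≤ Real.exp M := Real.exp_le_exp.mpr hu
    rw [h2]
    nlinarith [Real.exp_pos u]
  rcases le_total v u with h | h
  · rw [abs_of_nonneg (sub_nonneg.mpr (Real.exp_le_exp.mpr h)), abs_of_nonneg (sub_nonneg.mpr h)]
    exact key u v hu h
  · rw [abs_sub_comm, abs_sub_comm u v, abs_of_nonneg (sub_nonneg.mpr (Real.exp_le_exp.mpr h)),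
      abs_of_nonneg (sub_nonneg.mpr h)]
    exact key v u hv h

end Analysis

/-! ### Pseudo-random neighbourhoods -/

section Neighbourhoods

variable {n d : ℕ} {lam : ℝ} {G : SimpleGraph (Fin n)}

lemma nonneg_of_isNDLGraph (h : IsNDLGraph n d lam G) (hn : 2 ≤ n) : 0 ≤ lam := by
  obtain ⟨-, i₀, -, hi⟩ := h
  have : Nontrivial (Fin n) := Fin.nontrivial_iff_two_le.mpr hn
  obtain ⟨i, hne⟩ := exists_ne i₀
  exact (abs_nonneg _).trans (hi i hne)

/-- In a sparse `(n,d,λ)`-graph the second eigenvalue is of order at least `√d`. -/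
lemma le_four_mul_sq_of_isNDLGraph (h : IsNDLGraph n d lam G) (hn : 2 ≤ n) (hlam : lam < d)
    (hdn : (d : ℝ) ≤ n / 2) : (d : ℝ) ≤ 4 * lam ^ 2 := by
  classical
  have hn0 : (0 : ℝ) < n := by positivity
  let v : Fin n := ⟨0, by omega⟩
  have h1 := sum_sq_degInto_le_of_isNDLGraph h hn hlam {v}
  have h2 : ∑ w ∈ univ.filter (G.Adj v), (1 / 4 : ℝ) ≤
      ∑ w, ((degInto G {v} w : ℝ) - d * ({v} : Finset (Fin n)).card / n) ^ 2 := by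
    refine (Finset.sum_le_sum fun w hw => ?_).trans
      (Finset.sum_le_sum_of_subset_of_nonneg (Finset.subset_univ _) fun _ _ _ => sq_nonneg _)
    have hw' : G.Adj w v := (Finset.mem_filter.mp hw).2.symm
    have e : degInto G {v} w = 1 := by
      simp [degInto, Finset.filter_singleton, hw']
    have e' : (d : ℝ) / n ≤ 1 / 2 := by rw [div_le_iff₀ hn0]; linarith
    rw [e, Finset.card_singleton]
    push_cast
    rw [mul_one]
    nlinarith
  rw [Finset.sum_const, card_filter_adj_of_isNDLGraph h v, nsmul_eq_mul] at h2
  have h3 : lam ^ 2 * (({v} : Finset (Fin n)).card - (({v} : Finset (Fin n)).card : ℝ) ^ 2 / n) ≤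
      lam ^ 2 := by
    refine mul_le_of_le_one_right (sq_nonneg _) ?_
    rw [Finset.card_singleton]
    have : (0 : ℝ) ≤ 1 / n := by positivity
    push_cast
    linarith
  linarith

/-- The degrees into a set are close to their average value in mean. -/
lemma sum_abs_degInto_sub_le (h : IsNDLGraph n d lam G) (hn : 2 ≤ n) (hlam : lam < d)
    (Q : Finset (Fin n)) :
    ∑ w, |(degInto G Q w : ℝ) - d * (Q.card / n)| ≤ lam * n := by
  have hn0 : (0 : ℝ) < n := by positivity
  have hlam0 := nonneg_of_isNDLGraph h hn
  refine abs_le_of_sq_le_sq' ?_ (by positivity) |>.2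
  have h1 := sq_sum_le_card_mul_sum_sq (s := univ)
    (f := fun w : Fin n => |(degInto G Q w : ℝ) - d * (Q.card / n)|)
  have h2 := sum_sq_degInto_le_of_isNDLGraph h hn hlam Q
  have h3 : lam ^ 2 * ((Q.card : ℝ) - (Q.card : ℝ) ^ 2 / n) ≤ lam ^ 2 * n := by
    refine mul_le_mul_of_nonneg_left ?_ (sq_nonneg _)
    have h4 : (Q.card : ℝ) ≤ n := by
      exact_mod_cast (Finset.card_le_univ Q).trans_eq (Fintype.card_fin n)
    have h5 : (0 : ℝ) ≤ (Q.card : ℝ) ^ 2 / n := by positivity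
    linarith
  simp only [sq_abs, Finset.card_univ, Fintype.card_fin] at h1
  simp only [mul_div_assoc] at h2
  refine h1.trans ?_
  have := mul_le_mul_of_nonneg_left (h2.trans h3) hn0.le
  linarith

lemma log_inv_one_sub_bounds {c p a : ℝ} (hd : 8 ≤ d) (hc0 : 0 < c) (hc : c ≤ 1.01)
    (hp : p = c / d) (hap : a * (1 - p) = 1) :
    0 < a ∧ 0 ≤ Real.log a ∧ c ≤ Real.log a * d ∧ Real.log a * d ≤ c + 3 / d := by
  have hd8 : (8 : ℝ) ≤ d := by exact_mod_cast hd
  have hd0 : (0 : ℝ) < d := by linarith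
  have hp0 : 0 < p := by rw [hp]; positivity
  have hp1 : p ≤ 1 / 4 := by rw [hp, div_le_iff₀ hd0]; linarith
  have ha : a = 1 / (1 - p) := by rw [eq_div_iff (by linarith)]; exact hap
  have ha0 : 0 < a := by rw [ha]; exact div_pos one_pos (by linarith)
  have hl : p ≤ Real.log a := by
    have h1 := Real.log_le_sub_one_of_pos (by linarith : 0 < 1 - p)
    rw [ha, one_div, Real.log_inv]
    linarith
  have hu : Real.log a ≤ p + 2 * p ^ 2 := by
    have h1 := Real.log_le_sub_one_of_pos ha0
    have h2 : a ≤ 1 + p + 2 * p ^ 2 := by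
      rw [ha, div_le_iff₀ (by linarith)]
      nlinarith
    linarith
  refine ⟨ha0, hp0.le.trans hl, ?_, ?_⟩
  · have h1 : p * d = c := by rw [hp]; field_simp
    rw [← h1]
    exact mul_le_mul_of_nonneg_right hl hd0.le
  · have h1 := mul_le_mul_of_nonneg_right hu hd0.le
    have h2 : (p + 2 * p ^ 2) * d = c + 2 * c ^ 2 / d := by rw [hp]; field_simp
    have h3 : 2 * c ^ 2 / d ≤ 3 / d := by gcongr; nlinarith
    linarith

/-- The potential is close to a multiple of the number of vertices outside the neighbourhood. -/
lemma abs_potential_sub_le (h : IsNDLGraph n d lam G) (hn : 2 ≤ n) {δ a : ℝ}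
    (hδ : δ < 1) (hlam : lam ≤ δ * d) (hd : 0 < d) (ha : 0 < a) (hκ0 : 0 ≤ Real.log a)
    (hκd : Real.log a * d ≤ 2) (Q R : Finset (Fin n)) :
    |potential G a Q R - (n - (nbhd G R).card) * Real.exp (Real.log a * (d * (Q.card / n)))| ≤
      16 * δ * n := by
  classical
  have hn0 : (0 : ℝ) < n := by positivity
  have hd0 : (0 : ℝ) < d := by exact_mod_cast hd
  have hτ1 : (Q.card : ℝ) / n ≤ 1 := by
    rw [div_le_one hn0]
    exact_mod_cast (Finset.card_le_univ Q).trans_eq (Fintype.card_fin n)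
  set κ := Real.log a with hκ
  set τ : ℝ := Q.card / n with hτ
  set E := Real.exp (κ * (d * τ)) with hE
  have hpow : ∀ k : ℕ, a ^ k = Real.exp (κ * k) := fun k => by
    rw [mul_comm, Real.exp_nat_mul, hκ, Real.exp_log ha]
  have hterm : ∀ w, |a ^ degInto G Q w - E| ≤ 16 / d * |(degInto G Q w : ℝ) - d * τ| := by
    intro w
    have hw : (degInto G Q w : ℝ) ≤ d := by
      exact_mod_cast degInto_le G (card_filter_adj_of_isNDLGraph h) Q w
    have h1 := abs_exp_sub_exp_le (u := κ * degInto G Q w) (v := κ * (d * τ)) (M := κ * d)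
      (mul_le_mul_of_nonneg_left hw hκ0)
      (mul_le_mul_of_nonneg_left (mul_le_of_le_one_right hd0.le hτ1) hκ0)
    rw [hpow]
    refine h1.trans ?_
    rw [← mul_sub, abs_mul, abs_of_nonneg hκ0, ← mul_assoc]
    refine mul_le_mul_of_nonneg_right ?_ (abs_nonneg _)
    rw [le_div_iff₀ hd0, mul_assoc]
    have h2 : Real.exp (κ * d) ≤ 8 := by
      have h3 : Real.exp (κ * d) ≤ Real.exp (1 + 1) := Real.exp_le_exp.mpr (by linarith)
      rw [Real.exp_add] at h3
      nlinarith [Real.exp_one_lt_d9, Real.exp_pos 1]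
    nlinarith [Real.exp_pos (κ * d)]
  have hYsum : (n : ℝ) - (nbhd G R).card = ∑ w, if w ∈ nbhd G R then (0 : ℝ) else 1 := by
    have h1 : ∀ w, (if w ∈ nbhd G R then (0 : ℝ) else 1) = 1 - if w ∈ nbhd G R then 1 else 0 := by
      intro w; split_ifs <;> simp
    simp only [h1, Finset.sum_sub_distrib]
    simp
  have h1 : potential G a Q R - (n - (nbhd G R).card) * E =
      ∑ w, if w ∈ nbhd G R then 0 else (a ^ degInto G Q w - E) := by
    rw [hYsum, Finset.sum_mul, potential, ← Finset.sum_sub_distrib]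
    refine Finset.sum_congr rfl fun w _ => ?_
    split_ifs <;> ring
  rw [h1]
  calc |∑ w, if w ∈ nbhd G R then 0 else (a ^ degInto G Q w - E)|
      ≤ ∑ w, |if w ∈ nbhd G R then 0 else (a ^ degInto G Q w - E)| :=
        Finset.abs_sum_le_sum_abs _ _
    _ ≤ ∑ w, 16 / d * |(degInto G Q w : ℝ) - d * τ| := by
        refine Finset.sum_le_sum fun w _ => ?_
        split_ifs
        · rw [abs_zero]; positivity
        · exact hterm w
    _ ≤ 16 / d * (lam * n) := by
        rw [← Finset.mul_sum]
        exact mul_le_mul_of_nonneg_left (sum_abs_degInto_sub_le h hn (by nlinarith) Q)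
          (by positivity)
    _ ≤ 16 / d * (δ * d * n) := by gcongr
    _ = 16 * δ * n := by field_simp

/-- The size of the neighbourhood of `R`, when the potential of `(Q, R)` is close to `n`. -/
lemma abs_card_nbhd_sub_le (h : IsNDLGraph n d lam G) (hn : 2 ≤ n) {δ c p a ζ : ℝ}
    (hδ : δ < 1) (hlam : lam ≤ δ * d) (hd : 8 ≤ d) (hc0 : 0 < c) (hc : c ≤ 1.01)
    (hp : p = c / d) (hap : a * (1 - p) = 1) {Q R : Finset (Fin n)}
    (hZ : |potential G a Q R - n| ≤ ζ * n) :
    |((nbhd G R).card : ℝ) - n * (1 - Real.exp (-(c * (Q.card / n))))| ≤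
      (ζ + 16 * δ + 3 / d) * n := by
  have hn0 : (0 : ℝ) < n := by positivity
  have hd8 : (8 : ℝ) ≤ d := by exact_mod_cast hd
  obtain ⟨ha0, hκ0, hκl, hκu⟩ := log_inv_one_sub_bounds hd hc0 hc hp hap
  have h3d : 3 / (d : ℝ) ≤ 3 / 8 := by gcongr
  have hZY := abs_potential_sub_le h hn hδ hlam (by omega) ha0 hκ0 (by linarith) Q R
  generalize Real.log a = κ at *
  have hτ0 : 0 ≤ (Q.card : ℝ) / n := by positivity
  have hτ1 : (Q.card : ℝ) / n ≤ 1 := by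
    rw [div_le_one hn0]
    exact_mod_cast (Finset.card_le_univ Q).trans_eq (Fintype.card_fin n)
  generalize (Q.card : ℝ) / n = τ at *
  generalize potential G a Q R = Z at *
  generalize ((nbhd G R).card : ℝ) = N at *
  have hκd0 : 0 ≤ κ * (d * τ) := by positivity
  have hE1 : 1 ≤ Real.exp (κ * (d * τ)) := Real.one_le_exp hκd0
  have hYE : |(n - N) - n * Real.exp (-(κ * (d * τ)))| ≤ (ζ + 16 * δ) * n := by
    have h1 : ((n - N) - n * Real.exp (-(κ * (d * τ)))) * Real.exp (κ * (d * τ)) =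
        (n - N) * Real.exp (κ * (d * τ)) - n := by
      have : Real.exp (-(κ * (d * τ))) * Real.exp (κ * (d * τ)) = 1 := by
        rw [← Real.exp_add]; simp
      linear_combination -(n : ℝ) * this
    have h2 : |(n - N) * Real.exp (κ * (d * τ)) - n| ≤ (ζ + 16 * δ) * n := by
      rw [abs_le] at hZ hZY ⊢
      constructor <;> linarith [hZ.1, hZ.2, hZY.1, hZY.2]
    rw [← h1, abs_mul, abs_of_pos (Real.exp_pos _)] at h2
    exact (le_mul_of_one_le_right (abs_nonneg _) hE1).trans h2
  have hEE : |n * Real.exp (-(κ * (d * τ))) - n * Real.exp (-(c * τ))| ≤ 3 / d * n := by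
    rw [← mul_sub, abs_mul, abs_of_pos hn0, mul_comm]
    refine mul_le_mul_of_nonneg_right ?_ hn0.le
    have h1 := abs_exp_sub_exp_le (u := -(κ * (d * τ))) (v := -(c * τ)) (M := 0)
      (by linarith) (neg_nonpos.mpr (mul_nonneg hc0.le hτ0))
    rw [Real.exp_zero, one_mul] at h1
    refine h1.trans ?_
    have h2 : -(κ * (d * τ)) - -(c * τ) = -((κ * d - c) * τ) := by ring
    rw [h2, abs_neg, abs_of_nonneg (mul_nonneg (by linarith) hτ0)]
    exact (mul_le_of_le_one_right (by linarith) hτ1).trans (by linarith)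
  have hfin : N - n * (1 - Real.exp (-(c * τ))) =
      -(((n - N) - n * Real.exp (-(κ * (d * τ)))) +
        (n * Real.exp (-(κ * (d * τ))) - n * Real.exp (-(c * τ)))) := by ring
  rw [hfin, abs_neg]
  refine (abs_add_le _ _).trans ?_
  linarith

end Neighbourhoods

/-! ### The largest component -/

section Giant

lemma exp_neg_sub_exp_neg_le {s t : ℝ} (hs : 0 ≤ s) (hst : s ≤ t) :
    Real.exp (-s) - Real.exp (-t) ≤ 1 - Real.exp (-(t - s)) := by
  have h1 : Real.exp (-t) = Real.exp (-s) * Real.exp (-(t - s)) := by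
    rw [← Real.exp_add]; ring_nf
  have h2 : Real.exp (-s) ≤ 1 := Real.exp_le_one_iff.mpr (by linarith)
  have h3 : Real.exp (-(t - s)) ≤ 1 := Real.exp_le_one_iff.mpr (by linarith)
  rw [h1]
  nlinarith

variable {V : Type*} [Fintype V] [DecidableEq V] [Nonempty V] {G : SimpleGraph V} {ω : V → Bool}
  {ε x α d : ℝ} {n : ℕ}

/-- Some component is large, as soon as the exploration process follows its expected
trajectory. -/
lemma exists_le_ncard_supp (hV : Fintype.card V = n) (hε : 0 < ε) (hε' : ε < 1 / 100) (hx : 0 < x)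
    (hx1 : x < 1) (h : x = (1 + ε) * (1 - Real.exp (-x))) (hα : 0 < α) (hα' : α ≤ ε / 100)
    (hn : 1 ≤ α ^ 2 / 100 * n) (hd : 0 < d)
    (hF : ∀ t ≤ n, |((found G ω t).card : ℝ) - (1 + ε) / d * t| ≤ α ^ 2 / 4 * n / d)
    (hN : ∀ t ≤ n, |((nbhd G (found G ω t)).card : ℝ) -
      n * (1 - Real.exp (-((1 + ε) * (t / n))))| ≤ α ^ 2 / 4 * n) :
    ∃ C : (G.induce (percSet ω)).ConnectedComponent,
      (x - 7 * α) * n / d ≤ (C.supp.ncard : ℝ) := by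
  have hl := le_of_survival hε hε' hx h
  have hc : (0 : ℝ) < 1 + ε := by linarith
  have hn0 : (0 : ℝ) < n := by
    by_contra! h0
    have : (0 : ℝ) ≤ n := n.cast_nonneg
    nlinarith [sq_nonneg α]
  obtain ⟨y, hy⟩ : ∃ y, y = x / (1 + ε) := ⟨_, rfl⟩
  have hcy : (1 + ε) * y = x := by rw [hy]; field_simp
  have hfix : 1 - Real.exp (-((1 + ε) * y)) = y := by
    rw [hcy, hy, eq_div_iff hc.ne']; linarith
  have hy1 : y ≤ 1 := by rw [hy, div_le_one hc]; linarith
  have hyε : ε ≤ y := by rw [hy, le_div_iff₀ hc]; nlinarith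
  have hα1 : α ≤ 1 / 10000 := by linarith
  have hk0 : α * n ≤ (⌈α * n⌉₊ : ℝ) := Nat.le_ceil _
  have hk0' : (⌈α * n⌉₊ : ℝ) < α * n + 1 := Nat.ceil_lt_add_one (by positivity)
  have hk1 : (⌊(y - α) * n⌋₊ : ℝ) ≤ (y - α) * n :=
    Nat.floor_le (mul_nonneg (by linarith) hn0.le)
  have hk1' : (y - α) * n < (⌊(y - α) * n⌋₊ : ℝ) + 1 := Nat.lt_floor_add_one _
  have hα2 : α ^ 2 / 100 * n ≤ α / 100 * n := by gcongr; nlinarith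
  generalize ⌈α * n⌉₊ = k at *
  generalize ⌊(y - α) * n⌋₊ = l at *
  have hkl : k ≤ l := by
    have h1 : 100 * α * n ≤ y * n := by gcongr; linarith
    have : (k : ℝ) ≤ l := by nlinarith
    exact_mod_cast this
  have hln : l ≤ n := by
    have h1 : (y - α) * n ≤ 1 * n := by gcongr; linarith
    have : (l : ℝ) ≤ n := by linarith
    exact_mod_cast this
  obtain ⟨C, hC⟩ := exists_component G (ω := ω) hkl (hln.trans hV.ge) fun i hki hil => by
    have hki' : (k : ℝ) ≤ i := by exact_mod_cast hki
    have hil' : (i : ℝ) ≤ l := by exact_mod_cast hil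
    have h1 := le_one_sub_exp hε hε' hfix (by linarith) (by linarith)
      (by rw [mul_sub, hcy]; linarith) hα hα' (u := (i : ℝ) / n)
      ⟨by rw [le_div_iff₀ hn0]; linarith, by rw [div_le_iff₀ hn0]; linarith⟩
    have h2 := (abs_le.mp (hN i (hil.trans hln))).1
    have h3 := mul_le_mul_of_nonneg_left h1 hn0.le
    have h4 : (n : ℝ) * ((i : ℝ) / n + ε * α / 4) = i + ε * α / 4 * n := by field_simp
    have h5 : α ^ 2 / 4 * n < ε * α / 4 * n := by gcongr; nlinarith
    have : (i : ℝ) < ((nbhd G (found G ω i)).card : ℝ) := by linarith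
    exact_mod_cast this
  refine ⟨C, ?_⟩
  have h1 := (abs_le.mp (hF l hln)).1
  have h2 := (abs_le.mp (hF k (hkl.trans hln))).2
  have h3 : ((found G ω l).card : ℝ) ≤ C.supp.ncard + (found G ω k).card := by exact_mod_cast hC
  refine le_trans ?_ (by linarith : (1 + ε) / d * l - α ^ 2 / 4 * n / d -
    ((1 + ε) / d * k + α ^ 2 / 4 * n / d) ≤ (C.supp.ncard : ℝ))
  have h4 : (1 + ε) / d * l - α ^ 2 / 4 * n / d - ((1 + ε) / d * k + α ^ 2 / 4 * n / d) =
    ((1 + ε) * (l - k) - α ^ 2 / 2 * n) / d := by ring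
  rw [h4]
  gcongr
  have h5 : (1 + ε) * ((y - 2 * α) * n - 2) ≤ (1 + ε) * (l - k) :=
    mul_le_mul_of_nonneg_left (by linarith) hc.le
  have h6 : (1 + ε) * ((y - 2 * α) * n - 2) = x * n - (1 + ε) * (2 * (α * n) + 2) := by
    rw [← hcy]; ring
  have h7 : (1 + ε) * (2 * (α * n) + 2) ≤ 2 * (2 * (α * n) + 2) := by gcongr; linarith
  linarith

/-- No component is too large, as soon as the exploration process follows its expected
trajectory. -/
lemma ncard_supp_le (hV : Fintype.card V = n) (hε : 0 < ε) (hε' : ε < 1 / 100) (hx : 0 < x)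
    (hx1 : x < 1) (h : x = (1 + ε) * (1 - Real.exp (-x))) (hα : 0 < α) (hα' : α ≤ ε / 100)
    (hn : 1 ≤ α ^ 2 / 100 * n) (hd : 0 < d)
    (hF : ∀ t ≤ n, |((found G ω t).card : ℝ) - (1 + ε) / d * t| ≤ α ^ 2 / 4 * n / d)
    (hN : ∀ t ≤ n, |((nbhd G (found G ω t)).card : ℝ) -
      n * (1 - Real.exp (-((1 + ε) * (t / n))))| ≤ α ^ 2 / 4 * n)
    (C : (G.induce (percSet ω)).ConnectedComponent) :
    (C.supp.ncard : ℝ) ≤ (x + 7 * α) * n / d := by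
  have hl := le_of_survival hε hε' hx h
  have hc : (0 : ℝ) < 1 + ε := by linarith
  have hn0 : (0 : ℝ) < n := by
    by_contra! h0
    have : (0 : ℝ) ≤ n := n.cast_nonneg
    nlinarith [sq_nonneg α]
  obtain ⟨y, hy⟩ : ∃ y, y = x / (1 + ε) := ⟨_, rfl⟩
  have hcy : (1 + ε) * y = x := by rw [hy]; field_simp
  have hfix : 1 - Real.exp (-((1 + ε) * y)) = y := by
    rw [hcy, hy, eq_div_iff hc.ne']; linarith
  have hy1 : y ≤ 1 := by rw [hy, div_le_one hc]; linarith
  obtain ⟨s, t, hst, ht, hC, hts⟩ := exists_closed_times G ω C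
  rw [hV] at ht
  have hC' : (C.supp.ncard : ℝ) + (found G ω s).card ≤ (found G ω t).card := by exact_mod_cast hC
  have hts' : (t : ℝ) + (nbhd G (found G ω s)).card ≤ (nbhd G (found G ω t)).card + s + 1 := by
    exact_mod_cast hts
  have hst' : (s : ℝ) ≤ t := by exact_mod_cast hst.le
  have hu : ((t : ℝ) - s) / n ≤ y + α := by
    by_contra! hlt
    have h1 := one_sub_exp_le hfix (by linarith) (by rw [mul_sub, hcy]; linarith)
      (by linarith : y ≤ ((t : ℝ) - s) / n)
    have h2 := exp_neg_sub_exp_neg_le (s := (1 + ε) * (s / n)) (t := (1 + ε) * (t / n))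
      (by positivity) (by gcongr)
    rw [show (1 + ε) * (t / n) - (1 + ε) * (s / n) = (1 + ε) * (((t : ℝ) - s) / n) by ring] at h2
    have h3 := (abs_le.mp (hN s (hst.le.trans ht))).1
    have h4 := (abs_le.mp (hN t ht)).2
    have h5 : (t : ℝ) - s = n * (((t : ℝ) - s) / n) := by field_simp
    generalize ((t : ℝ) - s) / n = u at *
    have h6 := mul_le_mul_of_nonneg_left (h2.trans h1) hn0.le
    have h7 : ε / 2 * α ≤ ε / 2 * (u - y) := by gcongr; linarith
    have h8 := mul_le_mul_of_nonneg_left h7 hn0.le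
    have h9 : α ^ 2 * n < ε / 2 * α * n := by gcongr; nlinarith
    linarith
  rw [div_le_iff₀ hn0] at hu
  have h1 := (abs_le.mp (hF t ht)).2
  have h2 := (abs_le.mp (hF s (hst.le.trans ht))).1
  refine le_trans (by linarith : (C.supp.ncard : ℝ) ≤ (1 + ε) / d * t + α ^ 2 / 4 * n / d -
    ((1 + ε) / d * s - α ^ 2 / 4 * n / d)) ?_
  have h4 : (1 + ε) / d * t + α ^ 2 / 4 * n / d - ((1 + ε) / d * s - α ^ 2 / 4 * n / d) =
    ((1 + ε) * (t - s) + α ^ 2 / 2 * n) / d := by ring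
  rw [h4]
  gcongr
  have h5 : (1 + ε) * ((t : ℝ) - s) ≤ (1 + ε) * ((y + α) * n) := by gcongr
  have h6 : (1 + ε) * ((y + α) * n) = x * n + (1 + ε) * (α * n) := by rw [← hcy]; ring
  have h7 : (1 + ε) * (α * n) ≤ 2 * (α * n) := by gcongr; linarith
  have h8 : α ^ 2 / 2 * n ≤ α / 2 * n := by gcongr; nlinarith
  have h9 := mul_pos hα hn0
  linarith

lemma exists_largest_component (hV : Fintype.card V = n) (hε : 0 < ε) (hε' : ε < 1 / 100)
    (hx : 0 < x) (hx1 : x < 1) (h : x = (1 + ε) * (1 - Real.exp (-x))) (hα : 0 < α)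
    (hα' : α ≤ ε / 100) (hn : 1 ≤ α ^ 2 / 100 * n) (hd : 0 < d)
    (hF : ∀ t ≤ n, |((found G ω t).card : ℝ) - (1 + ε) / d * t| ≤ α ^ 2 / 4 * n / d)
    (hN : ∀ t ≤ n, |((nbhd G (found G ω t)).card : ℝ) -
      n * (1 - Real.exp (-((1 + ε) * (t / n))))| ≤ α ^ 2 / 4 * n) :
    ∃ C : (G.induce (percSet ω)).ConnectedComponent,
      (∀ C' : (G.induce (percSet ω)).ConnectedComponent, C'.supp.ncard ≤ C.supp.ncard) ∧
      |(C.supp.ncard : ℝ) - x * n / d| ≤ 7 * α * n / d := by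
  obtain ⟨C₀, hC₀⟩ := exists_le_ncard_supp hV hε hε' hx hx1 h hα hα' hn hd hF hN
  have : Nonempty (G.induce (percSet ω)).ConnectedComponent := ⟨C₀⟩
  have : Finite (G.induce (percSet ω)).ConnectedComponent := Quot.finite _
  obtain ⟨C, hC⟩ := Finite.exists_max
    fun C : (G.induce (percSet ω)).ConnectedComponent => C.supp.ncard
  refine ⟨C, hC, ?_⟩
  have h1 := ncard_supp_le hV hε hε' hx hx1 h hα hα' hn hd hF hN C
  have h2 : (C₀.supp.ncard : ℝ) ≤ C.supp.ncard := by exact_mod_cast hC C₀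
  rw [add_mul, add_div] at h1
  rw [sub_mul, sub_div] at hC₀
  rw [abs_le]
  constructor <;> linarith

end Giant

/-! ### The trajectory of the exploration process -/

section Trajectory

lemma sum_weight_filter_exists_le {V ι : Type*} [Fintype V] [DecidableEq V] {p : ℝ} (h0 : 0 ≤ p)
    (h1 : p ≤ 1) (s : Finset ι) (P : ι → (V → Bool) → Prop) [∀ j, DecidablePred (P j)]
    [DecidablePred fun ω => ∃ j ∈ s, P j ω] :
    ∑ ω with ∃ j ∈ s, P j ω, weight p ω ≤ ∑ j ∈ s, ∑ ω with P j ω, weight p ω := by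
  simp only [sum_filter]
  rw [sum_comm]
  refine sum_le_sum fun ω _ => ?_
  have hnn : ∀ j ∈ s, 0 ≤ if P j ω then weight p ω else 0 := fun j _ => by
    split_ifs
    exacts [weight_nonneg h0 h1 ω, le_rfl]
  split_ifs with h
  · obtain ⟨j, hj, hP⟩ := h
    refine le_trans ?_ (single_le_sum hnn hj)
    rw [if_pos hP]
  · exact sum_nonneg hnn

lemma sum_weight_filter_or_le {V : Type*} [Fintype V] [DecidableEq V] {p : ℝ} (h0 : 0 ≤ p)
    (h1 : p ≤ 1) (P Q : (V → Bool) → Prop) [DecidablePred P] [DecidablePred Q] :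
    ∑ ω with P ω ∨ Q ω, weight p ω ≤ ∑ ω with P ω, weight p ω + ∑ ω with Q ω, weight p ω := by
  classical
  rw [filter_or, ← sum_union_inter]
  exact le_add_of_nonneg_right (sum_nonneg fun ω _ => weight_nonneg h0 h1 ω)

variable {n d m : ℕ} {lam ε α a : ℝ} {G : SimpleGraph (Fin n)}

lemma abs_card_found_sub_le [Nonempty (Fin n)] {ω : Fin n → Bool} (hε : 0 < ε) (hε' : ε < 1 / 100)
    (hn : 1 ≤ α ^ 2 / 100 * n) (hn' : 0 < n) (hm : 0 < m) (hm' : 1 / (m : ℝ) ≤ α ^ 2 / 100)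
    (h : ∀ j ≤ m, |((found G ω (j * n / m)).card : ℝ) - (1 + ε) / d * (j * n / m : ℕ)| ≤
      α ^ 2 / 8 * n / d) {t : ℕ} (ht : t ≤ n) :
    |((found G ω t).card : ℝ) - (1 + ε) / d * t| ≤ α ^ 2 / 4 * n / d := by
  have hL : 0 ≤ (1 + ε) / d := by positivity
  refine (abs_sub_le_of_grid (F := fun t => ((found G ω t).card : ℝ))
    (g := fun t => (1 + ε) / d * t) hn' hm hL
    (fun s t hst => Nat.cast_le.mpr (card_le_card (found_mono G ω hst)))
    (fun s t _ => by rw [mul_sub]) h ht).trans ?_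
  have h1 : (n : ℝ) / m ≤ α ^ 2 / 100 * n := by
    rw [div_eq_mul_one_div, mul_comm]; gcongr
  have h2 : (1 + ε) * ((n : ℝ) / m + 1) ≤ 2 * (α ^ 2 / 50 * n) := by
    gcongr <;> linarith
  have h3 : α ^ 2 / 8 * n / d + (1 + ε) / d * ((n : ℝ) / m + 1) =
    (α ^ 2 / 8 * n + (1 + ε) * ((n : ℝ) / m + 1)) / d := by ring
  rw [h3]
  gcongr
  have : 0 ≤ α ^ 2 * n := by positivity
  linarith

lemma abs_card_nbhd_found_sub_le [Nonempty (Fin n)] {ω : Fin n → Bool} (hG : IsNDLGraph n d lam G)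
    (hε : 0 < ε) (hε' : ε < 1 / 100) (hα : 0 < α) (hα' : α ≤ 1 / 10000)
    (hlam : lam ≤ α ^ 4 * d) (hd : 8 ≤ d) (hd' : 1 ≤ 4 * α ^ 8 * d)
    (ha : a * (1 - (1 + ε) / d) = 1) (hn2 : 2 ≤ n)
    (hn : 1 ≤ α ^ 2 / 100 * n) (hm : 0 < m) (hm' : 1 / (m : ℝ) ≤ α ^ 2 / 100)
    (h : ∀ j ≤ m, |potential G a (queried G ω (j * n / m)) (found G ω (j * n / m)) - n| ≤
      α ^ 2 / 8 * n) {t : ℕ} (ht : t ≤ n) :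
    |((nbhd G (found G ω t)).card : ℝ) - n * (1 - Real.exp (-((1 + ε) * (t / n))))| ≤
      α ^ 2 / 4 * n := by
  have hn0 : (0 : ℝ) < n := by positivity
  have hd0 : (0 : ℝ) < d := by positivity
  refine (abs_sub_le_of_grid (F := fun t => ((nbhd G (found G ω t)).card : ℝ))
    (g := fun t : ℕ => n * (1 - Real.exp (-((1 + ε) * (t / n))))) (L := 1 + ε)
    (e := (α ^ 2 / 8 + 16 * α ^ 4 + 3 / d) * n) (by omega) hm (by linarith)
    (fun s t hst => Nat.cast_le.mpr (card_le_card (nbhd_mono G (found_mono G ω hst))))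
    (fun s t hst => ?_) (fun j hj => ?_) ht).trans ?_
  · have hst' : (s : ℝ) ≤ t := by exact_mod_cast hst
    have h1 := exp_neg_sub_exp_neg_le (s := (1 + ε) * (s / n)) (t := (1 + ε) * (t / n))
      (by positivity) (by gcongr)
    have h2 := Real.add_one_le_exp (-((1 + ε) * ((t : ℝ) / n) - (1 + ε) * (s / n)))
    have h3 := mul_le_mul_of_nonneg_left (h1.trans (by linarith :
      _ ≤ (1 + ε) * ((t : ℝ) / n) - (1 + ε) * (s / n))) hn0.le
    have h4 : (n : ℝ) * ((1 + ε) * ((t : ℝ) / n) - (1 + ε) * (s / n)) = (1 + ε) * (t - s) := by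
      field_simp
    linarith
  · have hjn : j * n / m ≤ n := Nat.div_le_of_le_mul (Nat.mul_le_mul_right n hj)
    have h1 := abs_card_nbhd_sub_le hG hn2 (pow_lt_one₀ hα.le (by linarith) (by norm_num)) hlam hd
      (by linarith) (by linarith) rfl ha (h j hj)
    rwa [card_queried G (hjn.trans_eq (Fintype.card_fin n).symm)] at h1
  · have h1 : (n : ℝ) / m ≤ α ^ 2 / 100 * n := by
      rw [div_eq_mul_one_div, mul_comm]; gcongr
    have h2 : (1 + ε) * ((n : ℝ) / m + 1) ≤ 2 * (α ^ 2 / 50 * n) := by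
      gcongr <;> linarith
    have h3 : 3 / (d : ℝ) ≤ 12 * α ^ 8 := by
      rw [div_le_iff₀ hd0]; linarith
    have h4 : α ^ 4 ≤ α ^ 2 / 1000 := by
      have : α ^ 2 ≤ 1 / 1000 := by nlinarith
      nlinarith [sq_nonneg α]
    have h5 : α ^ 8 ≤ α ^ 4 := pow_le_pow_of_le_one hα.le (by linarith) (by norm_num)
    have h6 : α ^ 2 / 8 + 16 * α ^ 4 + 3 / d ≤ α ^ 2 / 8 + α ^ 2 / 25 := by linarith [sq_nonneg α]
    have h7 := mul_le_mul_of_nonneg_right h6 hn0.le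
    have : 0 ≤ α ^ 2 * n := by positivity
    linarith

lemma one_le_and_mul_pow_le (hε : 0 < ε) (hε' : ε < 1 / 100) (hd : 8 ≤ d)
    (ha : a * (1 - (1 + ε) / d) = 1) : 1 ≤ a ∧ a * (d * a ^ d) ≤ 16 * d := by
  have hd8 : (8 : ℝ) ≤ d := by exact_mod_cast hd
  have hd0 : (0 : ℝ) < d := by linarith
  obtain ⟨ha0, -, -, hau⟩ := log_inv_one_sub_bounds hd (by linarith : 0 < 1 + ε) (by linarith)
    rfl ha
  have h0 : 0 ≤ (1 + ε) / d := by positivity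
  have h14 : (1 + ε) / d ≤ 1 / 4 := by rw [div_le_iff₀ hd0]; linarith
  have had : a ^ d ≤ 8 := by
    have e1 : a ^ d = Real.exp (Real.log a * d) := by
      rw [mul_comm, Real.exp_nat_mul, Real.exp_log ha0]
    have e2 : Real.log a * d ≤ 1 + 1 := by
      have : 3 / (d : ℝ) ≤ 3 / 8 := by gcongr
      linarith
    have e3 : Real.exp 1 ≤ 2.8 := by linarith [Real.exp_one_lt_d9]
    rw [e1]
    calc Real.exp (Real.log a * d) ≤ Real.exp 1 * Real.exp 1 := by
          rw [← Real.exp_add]; exact Real.exp_le_exp.mpr e2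
      _ ≤ 2.8 * 2.8 := by gcongr
      _ ≤ 8 := by norm_num
  generalize (1 + ε) / (d : ℝ) = p at *
  have ha2 : a ≤ 2 := by nlinarith
  refine ⟨by nlinarith, ?_⟩
  calc a * (d * a ^ d) ≤ 2 * (d * 8) := by gcongr
    _ = 16 * d := by ring

open Classical in
lemma sum_weight_filter_found_le [Nonempty (Fin n)] (hε : 0 < ε) (hε' : ε < 1 / 100) (hα : 0 < α)
    (hn : (0 : ℝ) < n) (hd : (0 : ℝ) < d) (hp : (1 + ε) / d ≤ 1) {t : ℕ} (ht : t ≤ n) :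
    ∑ ω with α ^ 2 / 8 * n / d < |((found G ω t).card : ℝ) - (1 + ε) / d * t|,
      weight ((1 + ε) / d) ω ≤ 100 * (d / n) / α ^ 4 := by
  have ht' : (t : ℝ) ≤ n := by exact_mod_cast ht
  have h0 : 0 ≤ (1 + ε) / d := by positivity
  refine (sum_weight_filter_le h0 hp (by positivity) _ (sum_weight_mul_card_found_sq_le G h0 hp
    (ht.trans_eq (Fintype.card_fin n).symm))).trans ?_
  calc (t : ℝ) * ((1 + ε) / d) / (α ^ 2 / 8 * n / d) ^ 2
      ≤ n * (1.5 / d) / (α ^ 2 / 8 * n / d) ^ 2 := by gcongr; linarith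
    _ = 96 * (d / n) / α ^ 4 := by field_simp; norm_num
    _ ≤ 100 * (d / n) / α ^ 4 := by gcongr; norm_num

open Classical in
lemma sum_weight_filter_potential_le [Nonempty (Fin n)] (hG : IsNDLGraph n d lam G) (hε : 0 < ε)
    (hε' : ε < 1 / 100) (hα : 0 < α) (hn : (0 : ℝ) < n) (hd : 8 ≤ d) (hp : (1 + ε) / d ≤ 1)
    (ha : a * (1 - (1 + ε) / d) = 1) {t : ℕ} (ht : t ≤ n) :
    ∑ ω with α ^ 2 / 8 * n < |potential G a (queried G ω t) (found G ω t) - n|,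
      weight ((1 + ε) / d) ω ≤ 19900 * (d / n) / α ^ 4 := by
  have ht' : (t : ℝ) ≤ n := by exact_mod_cast ht
  have hd0 : (0 : ℝ) < d := by positivity
  have h0 : 0 ≤ (1 + ε) / d := by positivity
  obtain ⟨ha1, had⟩ := one_le_and_mul_pow_le hε hε' hd ha
  have hM := sum_weight_mul_potential_sq_le G (card_filter_adj_of_isNDLGraph hG) h0 hp ha1 ha
    (ht.trans_eq (Fintype.card_fin n).symm)
  rw [Fintype.card_fin] at hM
  refine (sum_weight_filter_le h0 hp (by positivity) _ hM).trans ?_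
  have ha0 : 0 ≤ a * (d * a ^ d) := by positivity
  generalize a * (d * a ^ d) = A at *
  calc (t : ℝ) * ((1 + ε) / d * A ^ 2) / (α ^ 2 / 8 * n) ^ 2
      ≤ n * (1.2 / d * (16 * d) ^ 2) / (α ^ 2 / 8 * n) ^ 2 := by gcongr; linarith
    _ = 19660.8 * (d / n) / α ^ 4 := by field_simp; norm_num
    _ ≤ 19900 * (d / n) / α ^ 4 := by gcongr; norm_num

open Classical in
/-- With high probability the exploration process follows its expected trajectory on a grid. -/
lemma sum_weight_filter_grid_le [Nonempty (Fin n)] {β γ : ℝ} (hG : IsNDLGraph n d lam G)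
    (hε : 0 < ε) (hε' : ε < 1 / 100) (hα : 0 < α) (hn : (0 : ℝ) < n) (hd : 8 ≤ d)
    (hp : (1 + ε) / d ≤ 1) (ha : a * (1 - (1 + ε) / d) = 1) (hdn : (d : ℝ) ≤ β * n)
    (hβ : 20000 * (m + 1) * β ≤ γ * α ^ 4) :
    ∑ ω with ∃ j ∈ range (m + 1),
      (α ^ 2 / 8 * n / d < |((found G ω (j * n / m)).card : ℝ) - (1 + ε) / d * (j * n / m : ℕ)| ∨
        α ^ 2 / 8 * n < |potential G a (queried G ω (j * n / m)) (found G ω (j * n / m)) - n|),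
      weight ((1 + ε) / d) ω ≤ γ := by
  have hd0 : (0 : ℝ) < d := by positivity
  have h0 : 0 ≤ (1 + ε) / d := by positivity
  have hβd : (d : ℝ) / n ≤ β := by rwa [div_le_iff₀ hn]
  refine (sum_weight_filter_exists_le h0 hp (range (m + 1)) fun j ω =>
    α ^ 2 / 8 * n / d < |((found G ω (j * n / m)).card : ℝ) - (1 + ε) / d * (j * n / m : ℕ)| ∨
      α ^ 2 / 8 * n < |potential G a (queried G ω (j * n / m)) (found G ω (j * n / m)) - n|).trans
    ?_
  refine (sum_le_card_nsmul _ _ (20000 * β / α ^ 4) fun j hj => ?_).trans ?_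
  · have hjn : j * n / m ≤ n := Nat.div_le_of_le_mul
      (Nat.mul_le_mul_right n (Nat.lt_succ_iff.mp (mem_range.mp hj)))
    refine (sum_weight_filter_or_le h0 hp _ _).trans
      ((add_le_add (sum_weight_filter_found_le hε hε' hα hn hd0 hp hjn)
        (sum_weight_filter_potential_le hG hε hε' hα hn hd hp ha hjn)).trans ?_)
    rw [← add_div, ← add_mul]
    gcongr
    norm_num
  · rw [card_range, nsmul_eq_mul, mul_div_assoc', div_le_iff₀ (by positivity)]
    push_cast
    linarith

end Trajectory

end SitePercolation

/-- There is `ε₀ > 0` such that for every `ε ∈ (0, ε₀)`: the equation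
`x = (1+ε)(1-e^{-x})` has a unique solution `x ∈ (0,1)`, and for this `x`, for every
`α ∈ (0, ε⁸)` and `γ > 0` there are `β > 0` and `n₀` such that for all `n ≥ n₀`,
all `d` with `1 + ε ≤ d ≤ β n`, and every `(n,d,λ)`-graph `G` with `λ/d ≤ α^{2/α}`,
with probability at least `1 - γ` a largest connected component `L₁` of the
percolated subgraph satisfies `||V(L₁)| - x n/d| ≤ 7 α n / d`. -/
theorem giant_component_order :
    ∃ ε₀ > (0 : ℝ), ∀ ε : ℝ, 0 < ε → ε < ε₀ →
      (∃! x : ℝ, x ∈ Set.Ioo (0 : ℝ) 1 ∧ x = (1 + ε) * (1 - Real.exp (-x))) ∧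
      ∀ x : ℝ, x ∈ Set.Ioo (0 : ℝ) 1 → x = (1 + ε) * (1 - Real.exp (-x)) →
        ∀ α : ℝ, 0 < α → α < ε ^ 8 →
          ∀ γ > (0 : ℝ), ∃ β > (0 : ℝ), ∃ n₀ : ℕ,
            ∀ n : ℕ, n₀ ≤ n → ∀ d : ℕ, 1 + ε ≤ (d : ℝ) → (d : ℝ) ≤ β * n →
              ∀ (lam : ℝ) (G : SimpleGraph (Fin n)),
                IsNDLGraph n d lam G → lam / d ≤ α ^ ((2 : ℝ) / α) →
                  ENNReal.ofReal (1 - γ) ≤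
                    percolationMeasure (Fin n) ((1 + ε) / d)
                      {ω : Fin n → Bool |
                        ∃ C : (G.induce (percSet ω)).ConnectedComponent,
                          (∀ C' : (G.induce (percSet ω)).ConnectedComponent,
                            C'.supp.ncard ≤ C.supp.ncard) ∧
                          |(C.supp.ncard : ℝ) - x * n / d| ≤ 7 * α * n / d} := by
  classical
  refine ⟨1 / 100, by norm_num, fun ε hε hε' =>
    ⟨SitePercolation.existsUnique_survival hε hε', fun x hx hxε α hα hαε γ hγ => ?_⟩⟩
  have hαε' : α ≤ ε / 100 := by
    have h1 : ε ^ 8 ≤ ε ^ 2 := pow_le_pow_of_le_one hε.le (by linarith) (by norm_num)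
    nlinarith
  have hα1 : α ≤ 1 / 10000 := by linarith
  obtain ⟨m, hm⟩ : ∃ m : ℕ, m = ⌈100 / α ^ 2⌉₊ := ⟨_, rfl⟩
  have hm0 : 0 < m := hm ▸ Nat.ceil_pos.mpr (by positivity)
  have hm1 : 1 / (m : ℝ) ≤ α ^ 2 / 100 := by
    have : 100 / α ^ 2 ≤ (m : ℝ) := hm ▸ Nat.le_ceil _
    rw [← one_div_div 100 (α ^ 2)]
    exact one_div_le_one_div_of_le (by positivity) this
  refine ⟨min (γ * α ^ 4 / (20000 * (m + 1))) (α ^ 2 / 100), by positivity, 2,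
    fun n hn2 d hd1 hdn lam G hG hlam => ?_⟩
  obtain ⟨β, hβdef⟩ : ∃ β, β = min (γ * α ^ 4 / (20000 * (m + 1))) (α ^ 2 / 100) := ⟨_, rfl⟩
  rw [← hβdef] at hdn
  have hβ : 20000 * (m + 1) * β ≤ γ * α ^ 4 := by
    rw [mul_comm, ← le_div_iff₀ (by positivity)]
    exact hβdef ▸ min_le_left _ _
  have hβ' : β ≤ α ^ 2 / 100 := hβdef ▸ min_le_right _ _
  have hn0 : (0 : ℝ) < n := by positivity
  have hd0 : (0 : ℝ) < d := by linarith
  have hdn' : (d : ℝ) ≤ α ^ 2 / 100 * n := hdn.trans (by gcongr)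
  have hδ : lam ≤ α ^ 4 * d := by
    rw [div_le_iff₀ hd0] at hlam
    refine hlam.trans (mul_le_mul_of_nonneg_right ?_ hd0.le)
    rw [← Real.rpow_natCast]
    refine Real.rpow_le_rpow_of_exponent_ge hα (by linarith) ?_
    rw [le_div_iff₀ hα]
    push_cast
    linarith
  have hα4 : α ^ 4 ≤ 1 / 1000 := by
    have h1 : α ^ 4 ≤ α ^ 1 := pow_le_pow_of_le_one hα.le (by linarith) (by norm_num)
    linarith
  have hd4 : 1 ≤ 4 * α ^ 8 * d := by
    have h1 := SitePercolation.le_four_mul_sq_of_isNDLGraph hG hn2 (by nlinarith)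
      (by nlinarith)
    have h2 : lam ^ 2 ≤ (α ^ 4 * d) ^ 2 :=
      pow_le_pow_left₀ (SitePercolation.nonneg_of_isNDLGraph hG hn2) hδ 2
    have h3 : 1 * (d : ℝ) ≤ 4 * α ^ 8 * d * d := by linarith
    exact le_of_mul_le_mul_right h3 hd0
  have hd8 : 8 ≤ d := by
    have h1 : α ^ 8 ≤ α ^ 4 := pow_le_pow_of_le_one hα.le (by linarith) (by norm_num)
    have : (8 : ℝ) ≤ d := by nlinarith
    exact_mod_cast this
  have hp1 : (1 + ε) / d < 1 := by
    have : (8 : ℝ) ≤ d := by exact_mod_cast hd8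
    rw [div_lt_one hd0]; linarith
  have ha : (1 - (1 + ε) / d)⁻¹ * (1 - (1 + ε) / d) = 1 := inv_mul_cancel₀ (by linarith)
  have : Nonempty (Fin n) := ⟨⟨0, by omega⟩⟩
  refine SitePercolation.ofReal_one_sub_le_percolationMeasure (by positivity) hp1.le _
    (le_trans (sum_le_sum_of_subset_of_nonneg ?_
      fun ω _ _ => SitePercolation.weight_nonneg (by positivity) hp1.le ω)
      (SitePercolation.sum_weight_filter_grid_le hG hε hε' hα hn0 hd8 hp1.le ha hdn hβ))
  intro ω hω
  rw [mem_filter] at hω ⊢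
  refine ⟨mem_univ _, ?_⟩
  by_contra! hgood
  have hn1 : 1 ≤ α ^ 2 / 100 * n := by linarith
  exact hω.2 (SitePercolation.exists_largest_component (Fintype.card_fin n) hε hε' hx.1 hx.2 hxε
    hα hαε' hn1 hd0
    (fun t ht => SitePercolation.abs_card_found_sub_le hε hε' hn1 (by omega) hm0 hm1
      (fun j hj => (hgood j (mem_range.mpr (by omega))).1) ht)
    (fun t ht => SitePercolation.abs_card_nbhd_found_sub_le hG hε hε' hα hα1 hδ hd8 hd4 ha hn2 hn1
      hm0 hm1 (fun j hj => (hgood j (mem_range.mpr (by omega))).2) ht))
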